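/- arXiv:2201.06067 — 6 statements merged into one kernel-verified Lean document; each statement's English description precedes it below -/
import Mathlib

section
/- Fix points P, Q ∈ ℙ¹. (1) For every g ∈ 𝕄 with g(P) = Q, the number of h ∈ 𝕄 with h(P) ≠ Q and h(x) ≠ g(x) for all x ∈ ℙ¹ equals q²(q−1)/2. (2) For every h ∈ 𝕄 with h(P) ≠ Q, the number of g ∈ 𝕄 with g(P) = Q and g(x) ≠ h(x) for all x ∈ ℙ¹ equals q(q−1)/2. -/
noncomputable section

/-- The map `ℙ¹ → ℙ¹` induced by an invertible 2×2 matrix `M` over `F`,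
sending the class of `v` to the class of `M v`. -/
def indMap {F : Type} [Field F] (M : GL (Fin 2) F) :
    Projectivization F (Fin 2 → F) → Projectivization F (Fin 2 → F) :=
  Projectivization.map
    ((Matrix.GeneralLinearGroup.toLin M).toLinearEquiv : (Fin 2 → F) →ₗ[F] (Fin 2 → F))
    (Matrix.GeneralLinearGroup.toLin M).toLinearEquiv.injective

/-- The set `𝕄` of all maps `ℙ¹ → ℙ¹` induced by invertible 2×2 matrices over `F`,
i.e. the elements of `PGL(2,q)` acting on the projective line. -/
def pglMaps (F : Type) [Field F] :
    Set (Projectivization F (Fin 2 → F) → Projectivization F (Fin 2 → F)) :=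
  Set.range indMap

open Projectivization Matrix

section
variable {F : Type} [Field F]

theorem mulVec_ne_zero (M : GL (Fin 2) F) {v : Fin 2 → F} (hv : v ≠ 0) : M.1 *ᵥ v ≠ 0 := by
  intro h
  apply hv
  rw [← one_mulVec v, ← Units.val_one, ← inv_mul_cancel M, Units.val_mul, ← mulVec_mulVec, h,
    mulVec_zero]

theorem indMap_mk (M : GL (Fin 2) F) {v : Fin 2 → F} (hv : v ≠ 0) :
    indMap M (Projectivization.mk F v hv) =
      Projectivization.mk F (M.1 *ᵥ v) (mulVec_ne_zero M hv) :=
  rfl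

theorem indMap_mul (M N : GL (Fin 2) F) : indMap (M * N) = indMap M ∘ indMap N := by
  funext x
  induction x using Projectivization.ind with
  | h v hv => simp only [Function.comp_apply, indMap_mk, mulVec_mulVec, Units.val_mul]

theorem indMap_one : indMap (1 : GL (Fin 2) F) = id := by
  funext x
  induction x using Projectivization.ind with
  | h v hv => simp [indMap_mk]

theorem indMap_inv_apply (M : GL (Fin 2) F) (x : Projectivization F (Fin 2 → F)) :
    indMap M⁻¹ (indMap M x) = x := by
  rw [← Function.comp_apply (f := indMap M⁻¹), ← indMap_mul, inv_mul_cancel, indMap_one, id]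

theorem indMap_apply_inv (M : GL (Fin 2) F) (x : Projectivization F (Fin 2 → F)) :
    indMap M (indMap M⁻¹ x) = x := by
  simpa using indMap_inv_apply M⁻¹ x

variable (F) in
/-- The point `[1 : 0]` of the projective line. -/
def basePoint₀ : Projectivization F (Fin 2 → F) :=
  Projectivization.mk F ![1, 0] fun h => one_ne_zero (congrFun h 0)

variable (F) in
/-- The point `[0 : 1]` of the projective line. -/
def basePoint₁ : Projectivization F (Fin 2 → F) :=
  Projectivization.mk F ![0, 1] fun h => one_ne_zero (congrFun h 1)

theorem exists_indMap_basePoint {P R : Projectivization F (Fin 2 → F)} (h : P ≠ R) :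
    ∃ C : GL (Fin 2) F, indMap C (basePoint₀ F) = P ∧ indMap C (basePoint₁ F) = R := by
  induction P using Projectivization.ind with | h v hv =>
  induction R using Projectivization.ind with | h w hw =>
  have hdet : (!![v 0, w 0; v 1, w 1]).det ≠ 0 := by
    rw [det_fin_two_of]
    intro h0
    apply h
    rw [mk_eq_mk_iff']
    by_cases hw0 : w 0 = 0
    · have hw1 : w 1 ≠ 0 := fun h1 => hw (by ext i; fin_cases i <;> simp [hw0, h1])
      refine ⟨v 1 / w 1, ?_⟩
      ext i; fin_cases i <;> simp <;> field_simp; linear_combination -h0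
    · refine ⟨v 0 / w 0, ?_⟩
      ext i; fin_cases i <;> simp <;> field_simp; linear_combination h0
  refine ⟨GeneralLinearGroup.mkOfDetNeZero _ hdet, ?_, ?_⟩
  · rw [basePoint₀, indMap_mk, mk_eq_mk_iff']
    refine ⟨1, ?_⟩
    ext i; fin_cases i <;> simp [GeneralLinearGroup.mkOfDetNeZero]
  · rw [basePoint₁, indMap_mk, mk_eq_mk_iff']
    refine ⟨1, ?_⟩
    ext i; fin_cases i <;> simp [GeneralLinearGroup.mkOfDetNeZero]

/-- The matrix with characteristic polynomial `X² - d X - b` sending `(1, 0)` to `(0, 1)`. -/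
def companionGL (b d : F) (hb : b ≠ 0) : GL (Fin 2) F :=
  GeneralLinearGroup.mkOfDetNeZero !![0, b; 1, d] (by simpa [det_fin_two_of] using hb)

theorem companionGL_mulVec (b d : F) (hb : b ≠ 0) (v : Fin 2 → F) :
    (companionGL b d hb).1 *ᵥ v = ![b * v 1, v 0 + d * v 1] := by
  ext i; fin_cases i <;>
    simp [companionGL, GeneralLinearGroup.mkOfDetNeZero, mulVec, dotProduct, Fin.sum_univ_two]

theorem indMap_companionGL_basePoint (b d : F) (hb : b ≠ 0) :
    indMap (companionGL b d hb) (basePoint₀ F) = basePoint₁ F := by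
  rw [basePoint₀, basePoint₁, indMap_mk, mk_eq_mk_iff']
  refine ⟨1, ?_⟩
  rw [companionGL_mulVec]
  ext i; fin_cases i <;> simp

theorem companionGL_fixedPointFree_iff (b d : F) (hb : b ≠ 0) :
    (∀ x, indMap (companionGL b d hb) x ≠ x) ↔ ∀ t : F, t ^ 2 ≠ d * t + b := by
  constructor
  · intro h t ht
    refine h (Projectivization.mk F ![t - d, 1] fun h => one_ne_zero (congrFun h 1)) ?_
    rw [indMap_mk, mk_eq_mk_iff']
    refine ⟨t, ?_⟩
    rw [companionGL_mulVec]
    ext i; fin_cases i <;> simp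
    linear_combination ht
  · intro h x
    induction x using Projectivization.ind with | h v hv =>
    rw [indMap_mk, Ne, mk_eq_mk_iff']
    rintro ⟨t, ht⟩
    rw [companionGL_mulVec] at ht
    have h0 : t * v 0 = b * v 1 := by simpa using congrFun ht 0
    have h1 : t * v 1 = v 0 + d * v 1 := by simpa using congrFun ht 1
    by_cases hv1 : v 1 = 0
    · apply hv
      ext i; fin_cases i
      · simpa [hv1] using h1.symm
      · simpa using hv1
    · refine h t (mul_right_cancel₀ hv1 ?_)
      linear_combination t * h1 + h0

theorem companionGL_indMap_injective {b d b' d' : F} (hb : b ≠ 0) (hb' : b' ≠ 0)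
    (h : indMap (companionGL b d hb) = indMap (companionGL b' d' hb')) : b = b' ∧ d = d' := by
  have h1 := congrFun h (Projectivization.mk F ![0, 1] fun h => one_ne_zero (congrFun h 1))
  have h2 := congrFun h (Projectivization.mk F ![1, 1] fun h => one_ne_zero (congrFun h 1))
  rw [indMap_mk, indMap_mk, mk_eq_mk_iff'] at h1 h2
  simp only [companionGL_mulVec] at h1 h2
  obtain ⟨s, hs⟩ := h1
  obtain ⟨t, ht⟩ := h2
  have s0 : s * b' = b := by simpa using congrFun hs 0
  have s1 : s * d' = d := by simpa using congrFun hs 1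
  have t0 : t * b' = b := by simpa using congrFun ht 0
  have t1 : t * (1 + d') = 1 + d := by simpa using congrFun ht 1
  have hst : s = t := mul_right_cancel₀ hb' (s0.trans t0.symm)
  have hs : s = 1 := by subst hst; linear_combination t1 - s1
  rw [hs, one_mul] at s0 s1
  exact ⟨s0.symm, s1.symm⟩

theorem exists_companionGL {M : GL (Fin 2) F} (h : indMap M (basePoint₀ F) = basePoint₁ F) :
    ∃ b d hb, indMap M = indMap (companionGL b d hb) := by
  rw [basePoint₀, basePoint₁, indMap_mk, mk_eq_mk_iff'] at h
  obtain ⟨c, hc⟩ := h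
  have h0 : M.1 0 0 = 0 := by simpa [mulVec, dotProduct, Fin.sum_univ_two] using (congrFun hc 0).symm
  have h1 : M.1 1 0 = c := by simpa [mulVec, dotProduct, Fin.sum_univ_two] using (congrFun hc 1).symm
  have hdet : M.1.det ≠ 0 := (M.isUnit.map detMonoidHom).ne_zero
  rw [det_fin_two, h0, h1] at hdet
  have hc0 : c ≠ 0 := by rintro rfl; simp at hdet
  have hb0 : M.1 0 1 ≠ 0 := by intro h; simp [h] at hdet
  refine ⟨M.1 0 1 / c, M.1 1 1 / c, div_ne_zero hb0 hc0, ?_⟩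
  funext x
  induction x using Projectivization.ind with | h v hv =>
  rw [indMap_mk, indMap_mk, mk_eq_mk_iff']
  refine ⟨c, ?_⟩
  rw [companionGL_mulVec]
  ext i; fin_cases i <;> simp [mulVec, dotProduct, Fin.sum_univ_two, h0, h1] <;> field_simp

theorem two_mul_card_no_root [Fintype F] :
    2 * ({p : F × F | ∀ t : F, t ^ 2 ≠ p.2 * t + p.1}.ncard : ℝ) =
      Fintype.card F * (Fintype.card F - 1) := by
  classical
  let f : Sym2 F → F × F := Sym2.lift ⟨fun r s => (-(r * s), r + s), fun r s => by
    simp only [Prod.mk.injEq]; constructor <;> ring⟩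
  have hf : Function.Injective f := by
    intro x y
    induction x using Sym2.ind with | h r s =>
    induction y using Sym2.ind with | h r' s' =>
    intro h
    simp only [f, Sym2.lift_mk, Prod.mk.injEq] at h
    obtain ⟨h1, h2⟩ := h
    have : (r - r') * (r - s') = 0 := by linear_combination h1 + r * h2
    rw [Sym2.eq_iff]
    rcases mul_eq_zero.1 this with h | h
    · left; exact ⟨by linear_combination h, by linear_combination h2 - h⟩
    · right; exact ⟨by linear_combination h, by linear_combination h2 - h⟩
  have hcompl : {p : F × F | ∀ t : F, t ^ 2 ≠ p.2 * t + p.1}ᶜ = Set.range f := by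
    ext ⟨b, d⟩
    simp only [Set.mem_compl_iff, Set.mem_ofPred_eq, not_forall, not_not, Set.mem_range]
    constructor
    · rintro ⟨t, ht⟩
      refine ⟨s(t, d - t), ?_⟩
      simp only [f, Sym2.lift_mk, Prod.mk.injEq]
      constructor
      · linear_combination ht
      · ring
    · rintro ⟨x, hx⟩
      induction x using Sym2.ind with | h r s =>
      simp only [f, Sym2.lift_mk, Prod.mk.injEq] at hx
      refine ⟨r, ?_⟩
      rw [← hx.1, ← hx.2]; ring
  have hcard := Set.ncard_add_ncard_compl {p : F × F | ∀ t : F, t ^ 2 ≠ p.2 * t + p.1}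
  rw [hcompl, ← Set.image_univ, Set.ncard_image_of_injective _ hf, Set.ncard_univ,
    Nat.card_eq_fintype_card, Nat.card_eq_fintype_card, Sym2.card, Fintype.card_prod] at hcard
  have := congrArg (Nat.cast (R := ℝ)) hcard
  push_cast [Nat.cast_choose_two] at this
  linear_combination 2 * this

/-- Fixed-point-free projective maps sending `[1 : 0]` to `[0 : 1]` correspond to monic quadratic
polynomials without roots. -/
theorem ncard_fixedPointFree_basePoint [Fintype F] :
    {m | m ∈ pglMaps F ∧ m (basePoint₀ F) = basePoint₁ F ∧ ∀ x, m x ≠ x}.ncard =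
      {p : F × F | ∀ t : F, t ^ 2 ≠ p.2 * t + p.1}.ncard := by
  have hne : ∀ p ∈ {p : F × F | ∀ t : F, t ^ 2 ≠ p.2 * t + p.1}, p.1 ≠ 0 := by
    intro p hp h
    exact hp 0 (by simp [h])
  symm
  refine Set.ncard_congr (fun p hp => indMap (companionGL p.1 p.2 (hne p hp))) ?_ ?_ ?_
  · intro p hp
    exact ⟨⟨_, rfl⟩, indMap_companionGL_basePoint _ _ _,
      (companionGL_fixedPointFree_iff _ _ _).2 hp⟩
  · intro p p' hp hp' h
    have := companionGL_indMap_injective _ _ h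
    exact Prod.ext this.1 this.2
  · rintro m ⟨⟨M, rfl⟩, h1, h2⟩
    obtain ⟨b, d, hb, hM⟩ := exists_companionGL h1
    rw [hM] at h2
    exact ⟨(b, d), (companionGL_fixedPointFree_iff b d hb).1 h2, hM.symm⟩

/-- If `g P ≠ Q`, exactly `q(q-1)/2` projective maps sending `P` to `Q` agree with `g` nowhere. -/
theorem ncard_disjoint_of_apply_eq [Fintype F]
    {g : Projectivization F (Fin 2 → F) → Projectivization F (Fin 2 → F)}
    (hg : g ∈ pglMaps F) {P Q : Projectivization F (Fin 2 → F)} (hPQ : g P ≠ Q) :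
    ({h | h ∈ pglMaps F ∧ h P = Q ∧ ∀ x, h x ≠ g x}.ncard : ℝ) =
      Fintype.card F * (Fintype.card F - 1) / 2 := by
  obtain ⟨A, rfl⟩ := hg
  have hne : P ≠ indMap A⁻¹ Q := by
    rintro rfl
    exact hPQ (indMap_apply_inv A Q)
  obtain ⟨C, hC₀, hC₁⟩ := exists_indMap_basePoint hne
  have hset : {m | m ∈ pglMaps F ∧ m (basePoint₀ F) = basePoint₁ F ∧ ∀ x, m x ≠ x}.ncard =
      {h | h ∈ pglMaps F ∧ h P = Q ∧ ∀ x, h x ≠ indMap A x}.ncard := by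
    refine Set.ncard_congr (fun m _ => indMap A ∘ indMap C ∘ m ∘ indMap C⁻¹) ?_ ?_ ?_
    · rintro _ ⟨⟨M, rfl⟩, h1, h2⟩
      refine ⟨⟨A * (C * (M * C⁻¹)), by simp only [indMap_mul]⟩, ?_, ?_⟩
      · simp only [Function.comp_apply]
        rw [← hC₀, indMap_inv_apply, h1, hC₁, indMap_apply_inv]
      · intro x hx
        apply h2 (indMap C⁻¹ x)
        have := congrArg (fun y => indMap C⁻¹ (indMap A⁻¹ y)) hx
        simpa only [Function.comp_apply, indMap_inv_apply] using this
    · intro m m' _ _ h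
      funext x
      have := congrArg (fun y => indMap C⁻¹ (indMap A⁻¹ y)) (congrFun h (indMap C x))
      simpa only [Function.comp_apply, indMap_inv_apply] using this
    · rintro _ ⟨⟨H, rfl⟩, h1, h2⟩
      refine ⟨indMap (C⁻¹ * (A⁻¹ * (H * C))), ⟨⟨_, rfl⟩, ?_, ?_⟩, ?_⟩
      · simp only [indMap_mul, Function.comp_apply]
        rw [hC₀, h1, ← hC₁, indMap_inv_apply]
      · intro x hx
        apply h2 (indMap C x)
        have := congrArg (fun y => indMap A (indMap C y)) hx
        simpa only [indMap_mul, Function.comp_apply, indMap_apply_inv] using this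
      · simp only [← indMap_mul]
        congr 1
        group
  rw [← hset, ncard_fixedPointFree_basePoint]
  linear_combination two_mul_card_no_root (F := F) / 2

/-- Exactly `q²(q-1)/2` projective maps agree with `g` nowhere. The condition at `P` is implied
by the last one. -/
theorem ncard_disjoint_of_apply_ne [Fintype F]
    {g : Projectivization F (Fin 2 → F) → Projectivization F (Fin 2 → F)}
    (hg : g ∈ pglMaps F) (P : Projectivization F (Fin 2 → F)) :
    ({h | h ∈ pglMaps F ∧ h P ≠ g P ∧ ∀ x, h x ≠ g x}.ncard : ℝ) =
      (Fintype.card F : ℝ) ^ 2 * (Fintype.card F - 1) / 2 := by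
  classical
  have := Fintype.ofFinite (Projectivization F (Fin 2 → F))
  rw [Set.ncard_eq_toFinset_card', Finset.card_eq_sum_card_fiberwise (f := fun h => h P)
    (t := Finset.univ.erase (g P)) (by intro h hh; simpa using (Set.mem_toFinset.1 hh).2.1)]
  push_cast
  have hfib : ∀ R ∈ Finset.univ.erase (g P),
      ((({h | h ∈ pglMaps F ∧ h P ≠ g P ∧ ∀ x, h x ≠ g x}.toFinset.filter
        fun h => h P = R).card : ℕ) : ℝ) = Fintype.card F * (Fintype.card F - 1) / 2 := by
    intro R hR
    have hR := Finset.ne_of_mem_erase hR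
    rw [← ncard_disjoint_of_apply_eq hg hR.symm, Set.ncard_eq_toFinset_card']
    congr 2
    ext h
    simp only [Finset.mem_filter, Set.mem_toFinset, Set.mem_ofPred_eq]
    constructor
    · rintro ⟨⟨h1, -, h3⟩, h4⟩
      exact ⟨h1, h4, h3⟩
    · rintro ⟨h1, h2, h3⟩
      exact ⟨⟨h1, h3 P, h3⟩, h2⟩
  have hcard : (Finset.univ.erase (g P)).card = Fintype.card F := by
    rw [Finset.card_erase_of_mem (Finset.mem_univ _), Finset.card_univ,
      ← Nat.card_eq_fintype_card, card_of_finrank_two F (Fin 2 → F) (by simp),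
      Nat.card_eq_fintype_card, Nat.add_sub_cancel]
  rw [Finset.sum_congr rfl hfib, Finset.sum_const, hcard, nsmul_eq_mul]
  ring

end

/-- Degrees in the bipartite disjointness graph `G_P` on `PGL(2,q)`:
(1) every `g ∈ 𝕄` with `g(P) = Q` is disjoint from exactly `q²(q−1)/2` elements `h ∈ 𝕄`
with `h(P) ≠ Q`; (2) every `h ∈ 𝕄` with `h(P) ≠ Q` is disjoint from exactly `q(q−1)/2`
elements `g ∈ 𝕄` with `g(P) = Q`. -/
theorem stmt_11 (q : ℕ) (hq : IsPrimePow q)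
    (F : Type) [Field F] [Fintype F] (hF : Fintype.card F = q)
    (P Q : Projectivization F (Fin 2 → F)) :
    (∀ g ∈ pglMaps F, g P = Q →
      (({h | h ∈ pglMaps F ∧ h P ≠ Q ∧ ∀ x, h x ≠ g x}.ncard : ℝ)
        = (q : ℝ) ^ 2 * ((q : ℝ) - 1) / 2)) ∧
    (∀ h ∈ pglMaps F, h P ≠ Q →
      (({g | g ∈ pglMaps F ∧ g P = Q ∧ ∀ x, g x ≠ h x}.ncard : ℝ)
        = (q : ℝ) * ((q : ℝ) - 1) / 2)) := by
  subst hF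
  refine ⟨fun g hg hgP => ?_, fun h hh hhP => ncard_disjoint_of_apply_eq hh hhP⟩
  subst hgP
  exact ncard_disjoint_of_apply_ne hg P
end
end

section
/- Let q be odd. For all points P, Q ∈ ℙ¹, the number of invertible 2×2 matrices M over F whose induced map sends P to Q and whose determinant is a square in F equals the number of invertible 2×2 matrices M over F whose induced map sends P to Q and whose determinant is a non-square in F. (That is, half of the circles of the ovoidal Minkowski plane of odd order q through any point are of square type.) -/
/-- In a finite field, multiplication by a non-square exchanges nonzero squares and non-squares. -/
lemma FiniteField.isSquare_mul_iff_not_isSquare {F : Type*} [Field F] [Fintype F] {a e : F}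
    (ha : a ≠ 0) (he : ¬ IsSquare e) : IsSquare (a * e) ↔ ¬ IsSquare a := by
  classical
  have he0 : e ≠ 0 := by
    rintro rfl
    exact he IsSquare.zero
  have hF : ringChar F ≠ 2 := fun h ↦ he (FiniteField.isSquare_of_char_two h e)
  rw [← quadraticChar_one_iff_isSquare (mul_ne_zero ha he0), map_mul,
    quadraticChar_neg_one_iff_not_isSquare.mpr he,
    ← quadraticChar_neg_one_iff_not_isSquare (F := F)]
  omega

/-- Every nonzero plane vector is fixed by some matrix of any prescribed determinant. -/
lemma Matrix.exists_det_eq_mulVec_eq_self {F : Type*} [Field F] {v : Fin 2 → F} (hv : v ≠ 0)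
    (e : F) : ∃ D : Matrix (Fin 2) (Fin 2) F, D.det = e ∧ D.mulVec v = v := by
  by_cases h0 : v 0 = 0
  · have h1 : v 1 ≠ 0 := by
      intro h1
      apply hv
      ext i
      fin_cases i <;> simp [h0, h1]
    refine ⟨!![e, 0; 0, 1], by simp [Matrix.det_fin_two], ?_⟩
    ext i
    fin_cases i <;> simp [Matrix.mulVec, dotProduct, Fin.sum_univ_two, h0]
  · refine ⟨!![1, 0; (1 - e) * v 1 / v 0, e], by simp [Matrix.det_fin_two], ?_⟩
    ext i
    fin_cases i
    · simp [Matrix.mulVec, dotProduct, Fin.sum_univ_two]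
    · simp [Matrix.mulVec, dotProduct, Fin.sum_univ_two]
      field_simp
      ring

/-- For `q` odd and points `P, Q` of `ℙ¹`, the number of invertible 2×2 matrices over `F`
sending (the class of) `P` to `Q` with square determinant equals the number of those with
non-square determinant: half of the circles of the ovoidal Minkowski plane of odd order
through any point are of square type. -/
theorem stmt_12 (q : ℕ) (hq : Odd q) (hqp : IsPrimePow q)
    (F : Type) [Field F] [Fintype F] (hF : Fintype.card F = q)
    (P Q : Projectivization F (Fin 2 → F)) :
    {M : Matrix (Fin 2) (Fin 2) F | IsUnit M.det ∧
        (∃ c : F, c ≠ 0 ∧ M.mulVec P.rep = c • Q.rep) ∧ IsSquare M.det}.ncard =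
      {M : Matrix (Fin 2) (Fin 2) F | IsUnit M.det ∧
        (∃ c : F, c ≠ 0 ∧ M.mulVec P.rep = c • Q.rep) ∧ ¬ IsSquare M.det}.ncard := by
  have hchar : ringChar F ≠ 2 := by
    intro h
    have := FiniteField.even_card_of_char_two h
    rw [hF] at this
    obtain ⟨k, hk⟩ := hq
    omega
  obtain ⟨e, he⟩ := FiniteField.exists_nonsquare hchar
  have he0 : e ≠ 0 := by
    rintro rfl
    exact he IsSquare.zero
  obtain ⟨D, rfl, hDv⟩ := Matrix.exists_det_eq_mulVec_eq_self P.rep_nonzero e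
  have hD : IsUnit D.det := he0.isUnit
  have hDinv : D⁻¹.mulVec P.rep = P.rep := by
    conv_lhs => rw [← hDv]
    rw [Matrix.mulVec_mulVec, Matrix.nonsing_inv_mul _ hD, Matrix.one_mulVec]
  refine Set.ncard_congr (fun M _ ↦ M * D) ?_ ?_ ?_
  · rintro M ⟨hM, ⟨c, hc, hcM⟩, hs⟩
    refine ⟨by rw [Matrix.det_mul]; exact hM.mul hD, ⟨c, hc, ?_⟩, ?_⟩
    · rw [← Matrix.mulVec_mulVec, hDv, hcM]
    · rw [Matrix.det_mul, FiniteField.isSquare_mul_iff_not_isSquare hM.ne_zero he]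
      exact not_not.mpr hs
  · intro M N _ _ h
    simpa [Matrix.mul_assoc, Matrix.mul_nonsing_inv _ hD] using congrArg (· * D⁻¹) h
  · rintro N ⟨hN, ⟨c, hc, hcN⟩, hs⟩
    have hND : N * D⁻¹ * D = N := Matrix.nonsing_inv_mul_cancel_right _ _ hD
    have hdet : (N * D⁻¹).det * D.det = N.det := by rw [← Matrix.det_mul, hND]
    have hne : (N * D⁻¹).det ≠ 0 := left_ne_zero_of_mul (hdet ▸ hN.ne_zero)
    refine ⟨N * D⁻¹, ⟨hne.isUnit, ⟨c, hc, ?_⟩, ?_⟩, hND⟩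
    · rw [← Matrix.mulVec_mulVec, hDinv, hcN]
    · rwa [← hdet, FiniteField.isSquare_mul_iff_not_isSquare hne he, not_not] at hs
end

section
/- Let 𝒻 ⊆ 𝕄 be an intersecting family, i.e. for all f, g ∈ 𝒻 there exists x ∈ ℙ¹ with f(x) = g(x). Let P, Q ∈ ℙ¹. If the number of f ∈ 𝒻 with f(P) = Q is strictly greater than q(q−1)/2, then f(P) = Q for every f ∈ 𝒻. -/
noncomputable section

open Projectivization in
/-- The map `f` on the projective space is given by the linear map `A` on representatives. -/
def IsInducedBy {F V : Type*} [Field F] [AddCommGroup V] [Module F V]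
    (f : Projectivization F V → Projectivization F V) (A : V →ₗ[F] V) : Prop :=
  ∀ (x : V) (hx : x ≠ 0), ∃ h : A x ≠ 0, f (mk F x hx) = mk F (A x) h

section IsInducedBy

variable {F V : Type*} [Field F] [AddCommGroup V] [Module F V]
  {f g : Projectivization F V → Projectivization F V} {A G : V →ₗ[F] V}

theorem IsInducedBy.injective (h : IsInducedBy f A) : Function.Injective A := by
  rw [injective_iff_map_eq_zero]
  intro x hx
  by_contra h0
  exact (h x h0).1 hx

theorem IsInducedBy.eq (hf : IsInducedBy f A) (hg : IsInducedBy g A) : f = g := by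
  funext x
  induction x using Projectivization.ind with
  | h x hx => rw [(hf x hx).2, (hg x hx).2]

theorem IsInducedBy.exists_map_eq (h : IsInducedBy f A) {v u : V} (hv : v ≠ 0) (hu : u ≠ 0)
    (hvu : f (Projectivization.mk F v hv) = Projectivization.mk F u hu) :
    ∃ B : V →ₗ[F] V, IsInducedBy f B ∧ B v = u := by
  obtain ⟨hAv, e⟩ := h v hv
  rw [hvu, Projectivization.mk_eq_mk_iff] at e
  obtain ⟨c, hc⟩ := e
  refine ⟨(c : F) • A, fun x hx => ?_, by simpa [Units.smul_def] using hc⟩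
  obtain ⟨h1, h2⟩ := h x hx
  refine ⟨smul_ne_zero c.ne_zero h1, ?_⟩
  rw [h2, Projectivization.mk_eq_mk_iff]
  exact ⟨c⁻¹, by simp [Units.smul_def, smul_smul]⟩

theorem IsInducedBy.exists_map_eq_smul (hf : IsInducedBy f A) (hg : IsInducedBy g G)
    (h : ∃ x, f x = g x) : ∃ (x : V) (c : Fˣ), x ≠ 0 ∧ A x = (c : F) • G x := by
  obtain ⟨x, hx⟩ := h
  induction x using Projectivization.ind with
  | h x h0 =>
    rw [(hf x h0).2, (hg x h0).2, Projectivization.mk_eq_mk_iff] at hx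
    obtain ⟨c, hc⟩ := hx
    exact ⟨x, c, h0, hc.symm⟩

/-- If `A v = G w` and `G⁻¹ A` has an eigenvector, then its action on the basis `v, w` is
that of the companion matrix of a split quadratic polynomial. -/
theorem exists_units_map_eq_of_map_eq_smul (hA : Function.Injective A) (hG : Function.Injective G)
    {v w : V} (hvw : LinearIndependent F ![v, w]) (hAv : A v = G w)
    (hspan : ∀ x : V, ∃ a b : F, x = a • v + b • w)
    {x : V} {r : Fˣ} (hx : x ≠ 0) (hAx : A x = (r : F) • G x) :
    ∃ s : Fˣ, A w = ((r : F) + s) • G w - ((r : F) * s) • G v := by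
  rw [LinearIndependent.pair_iff] at hvw
  obtain ⟨a, b, rfl⟩ := hspan x
  have hb : b ≠ 0 := by
    rintro rfl
    have key : (-(r : F) * a) • v + a • w = 0 := by
      apply hG
      simp only [map_add, map_smul, hAv, zero_smul, add_zero] at hAx ⊢
      rw [map_zero, hAx]
      module
    simp [(hvw _ _ key).2] at hx
  have hAw : A w = ((r : F) - a / b) • G w + (r * (a / b)) • G v := by
    simp only [map_add, map_smul, hAv] at hAx
    have h1 : b • A w = (r * b - a) • G w + (r * a) • G v := by
      rw [eq_sub_of_add_eq' hAx]
      module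
    have h2 : A w = b⁻¹ • (b • A w) := by rw [smul_smul, inv_mul_cancel₀ hb, one_smul]
    rw [h2, h1, smul_add, smul_smul, smul_smul]
    congr 2 <;> field_simp
  have ha : a ≠ 0 := by
    rintro rfl
    have h0 : w - (r : F) • v = 0 := by
      apply (injective_iff_map_eq_zero A).1 hA
      rw [map_sub, map_smul, hAw, hAv]
      module
    have h1 := hvw (-(r : F)) 1 (by rw [← h0]; module)
    exact one_ne_zero h1.2
  refine ⟨Units.mk0 (-(a / b)) (neg_ne_zero.2 (div_ne_zero ha hb)), ?_⟩
  rw [hAw, Units.val_mk0]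
  module

end IsInducedBy

theorem exists_isInducedBy_of_mem_pglMaps {F : Type} [Field F]
    {f : Projectivization F (Fin 2 → F) → Projectivization F (Fin 2 → F)} (hf : f ∈ pglMaps F) :
    ∃ A : (Fin 2 → F) →ₗ[F] (Fin 2 → F), IsInducedBy f A ∧ Function.Surjective A := by
  obtain ⟨M, rfl⟩ := hf
  exact ⟨((Matrix.GeneralLinearGroup.toLin M).toLinearEquiv : (Fin 2 → F) →ₗ[F] (Fin 2 → F)),
    fun x hx => ⟨_, Projectivization.map_mk _ _ _ _⟩,
    (Matrix.GeneralLinearGroup.toLin M).toLinearEquiv.surjective⟩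

/-- At most `q (q - 1) / 2` elements of `PGL(2,q)` send `P` to `Q` and intersect a given
element that does not send `P` to `Q`. -/
theorem ncard_le_card_sym2_of_forall_exists_eq {F : Type} [Field F] [Fintype F]
    {g : Projectivization F (Fin 2 → F) → Projectivization F (Fin 2 → F)} (hg : g ∈ pglMaps F)
    {P Q : Projectivization F (Fin 2 → F)} (hgP : g P ≠ Q)
    {S : Set (Projectivization F (Fin 2 → F) → Projectivization F (Fin 2 → F))}
    (hS : S ⊆ pglMaps F) (hSP : ∀ f ∈ S, f P = Q) (hSg : ∀ f ∈ S, ∃ x, f x = g x) :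
    S.ncard ≤ Nat.card (Sym2 Fˣ) := by
  obtain ⟨G, hG, hGs⟩ := exists_isInducedBy_of_mem_pglMaps hg
  induction P using Projectivization.ind with | h v hv => ?_
  induction Q using Projectivization.ind with | h u hu => ?_
  obtain ⟨w, rfl⟩ := hGs u
  have hvw : LinearIndependent F ![v, w] := by
    rw [LinearIndependent.pair_iff' hv]
    rintro c rfl
    apply hgP
    rw [(hG v hv).2, Eq.comm, Projectivization.mk_eq_mk_iff']
    exact ⟨c, by simp⟩
  have hspan : ∀ x : Fin 2 → F, ∃ a b : F, x = a • v + b • w := by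
    intro x
    have h := hvw.span_eq_top_of_card_eq_finrank' (by simp)
    have hx : x ∈ Submodule.span F (Set.range ![v, w]) := h ▸ Submodule.mem_top
    rw [Matrix.range_cons, Matrix.range_cons, Matrix.range_empty, Set.union_empty,
      Set.singleton_union, Submodule.mem_span_pair] at hx
    obtain ⟨a, b, h⟩ := hx
    exact ⟨a, b, h.symm⟩
  have key : ∀ f : S, ∃ p : Fˣ × Fˣ, ∃ A, IsInducedBy f.1 A ∧ A v = G w ∧
      A w = ((p.1 : F) + p.2) • G w - ((p.1 : F) * p.2) • G v := by
    rintro ⟨f, hf⟩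
    obtain ⟨B, hB, -⟩ := exists_isInducedBy_of_mem_pglMaps (hS hf)
    obtain ⟨A, hA, hAv⟩ := hB.exists_map_eq hv hu (hSP f hf)
    obtain ⟨x, r, hx, hAx⟩ := hA.exists_map_eq_smul hG (hSg f hf)
    obtain ⟨s, hs⟩ :=
      exists_units_map_eq_of_map_eq_smul hA.injective hG.injective hvw hAv hspan hx hAx
    exact ⟨(r, s), A, hA, hAv, hs⟩
  choose p A hA hAv hAw using key
  rw [← Nat.card_coe_set_eq]
  refine Nat.card_le_card_of_injective (fun f => Sym2.mk (p f).1 (p f).2) fun f₁ f₂ h => ?_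
  have hw : A f₁ w = A f₂ w := by
    rw [hAw, hAw]
    rcases Sym2.eq_iff.1 h with ⟨h1, h2⟩ | ⟨h1, h2⟩
    · rw [h1, h2]
    · rw [h1, h2, add_comm, mul_comm]
  have hAA : A f₁ = A f₂ := by
    refine LinearMap.ext fun x => ?_
    obtain ⟨a, b, rfl⟩ := hspan x
    simp only [map_add, map_smul, hAv, hw]
  exact Subtype.ext ((hA f₁).eq (hAA ▸ hA f₂))

/-- **Hilton–Milner-type lemma for `PGL(2,q)`.** If an intersecting family `𝒻 ⊆ 𝕄`
contains more than `q(q−1)/2` elements sending `P` to `Q`, then every element of `𝒻`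
sends `P` to `Q`. -/
theorem stmt_14 (q : ℕ) (hq : IsPrimePow q)
    (F : Type) [Field F] [Fintype F] (hF : Fintype.card F = q)
    (𝒻 : Set (Projectivization F (Fin 2 → F) → Projectivization F (Fin 2 → F)))
    (h𝒻 : 𝒻 ⊆ pglMaps F)
    (hint : ∀ f ∈ 𝒻, ∀ g ∈ 𝒻, ∃ x, f x = g x)
    (P Q : Projectivization F (Fin 2 → F))
    (hmany : (q : ℝ) * ((q : ℝ) - 1) / 2 < (({f ∈ 𝒻 | f P = Q}).ncard : ℝ)) :
    ∀ f ∈ 𝒻, f P = Q := by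
  intro g hg
  by_contra hgP
  have h := ncard_le_card_sym2_of_forall_exists_eq (h𝒻 hg) hgP
    (S := {f ∈ 𝒻 | f P = Q}) (fun f hf => h𝒻 hf.1) (fun f hf => hf.2)
    (fun f hf => hint f hf.1 g hg)
  have hq1 : Nat.card Fˣ + 1 = q := by
    classical
    rw [Nat.card_eq_fintype_card, Fintype.card_units, hF, Nat.sub_add_cancel hq.one_lt.le]
  have hc : (Nat.card (Sym2 Fˣ) : ℝ) = (q : ℝ) * ((q : ℝ) - 1) / 2 := by
    classical
    rw [Nat.card_eq_fintype_card, Sym2.card, ← Nat.card_eq_fintype_card, hq1, Nat.cast_choose_two]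
  rw [← hc] at hmany
  exact absurd h (not_le.2 (by exact_mod_cast hmany))
end
end

section
/- Assume the number of isotropic points of ℙ(F⁴) is q² + 1 (elliptic quadric). Let 𝒻 be an intersecting family of non-isotropic points of ℙ(F⁴), i.e. for all P, R ∈ 𝒻 there is an isotropic point S whose representatives s satisfy b(s,p) = 0 and b(s,r) = 0 for representatives p of P and r of R. Let S be an isotropic point. If the number of P ∈ 𝒻 whose representatives p satisfy b(s,p) = 0 (for representatives s of S) is strictly greater than (q+2)(q+1)/2, then b(s,p) = 0 holds for every P ∈ 𝒻. -/
/-- The `X`-coefficient of the normalized linear form indexed by `a`, which is `Y` for `none`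
and `X + uY` for `some u`. -/
def linX {F : Type} [Field F] (a : Option F) : F := a.elim 0 fun _ => 1

/-- The `Y`-coefficient of the normalized linear form indexed by `a`. -/
def linY {F : Type} [Field F] (a : Option F) : F := a.elim 1 id

lemma exists_smul_linX_linY {F : Type} [Field F] (x y : F) (h : x ≠ 0 ∨ y ≠ 0) :
    ∃ (c : F) (a : Option F), c ≠ 0 ∧ x = c * linX a ∧ y = c * linY a := by
  by_cases hx : x = 0
  · exact ⟨y, none, by tauto, by simp [linX, hx], by simp [linY]⟩
  · exact ⟨x, some (y / x), hx, by simp [linX], by simp [linY]; field_simp⟩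

/-- A nonzero binary quadratic form over a field with a nontrivial zero is, up to a scalar,
the product of two normalized linear forms. -/
lemma exists_factorization_of_zero {F : Type} [Field F] (A B C ξ η : F)
    (hABC : ¬ (A = 0 ∧ B = 0 ∧ C = 0)) (hne : ξ ≠ 0 ∨ η ≠ 0)
    (h0 : A * ξ ^ 2 + B * (ξ * η) + C * η ^ 2 = 0) :
    ∃ (c : F) (a b : Option F), c ≠ 0 ∧ A = c * (linX a * linX b) ∧
      B = c * (linX a * linY b + linY a * linX b) ∧ C = c * (linY a * linY b) := by
  by_cases hη : η = 0
  · subst hη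
    have hA : A = 0 := by
      have : ξ ≠ 0 := by tauto
      simpa [this] using h0
    obtain ⟨c, b, hc, h1, h2⟩ := exists_smul_linX_linY B C (by tauto)
    exact ⟨c, none, b, hc, by simp [linX, hA], by simp [h1, linX, linY],
      by simp [h2, linY]⟩
  · obtain ⟨r, rfl⟩ : ∃ r, ξ = r * η := ⟨ξ / η, by field_simp⟩
    have hr : A * r ^ 2 + B * r + C = 0 := by
      have : η ^ 2 * (A * r ^ 2 + B * r + C) = 0 := by linear_combination h0
      simpa [hη] using this
    have hne' : A ≠ 0 ∨ B + A * r ≠ 0 := by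
      by_contra! hcon
      obtain ⟨hA, hB⟩ := hcon
      subst hA
      have hB : B = 0 := by simpa using hB
      subst hB
      exact hABC ⟨rfl, rfl, by simpa using hr⟩
    obtain ⟨c, b, hc, h1, h2⟩ := exists_smul_linX_linY A (B + A * r) hne'
    refine ⟨c, some (-r), b, hc, by simp [linX, h1], ?_, ?_⟩
    · simp only [linX, linY, Option.elim, id] at *
      linear_combination h2 - r * h1
    · simp only [linX, linY, Option.elim, id] at *
      linear_combination hr - r * h2

/-- A set of points is bounded by the number of unordered pairs of linear forms if it is
mapped linearly and injectively to binary quadratic forms with nontrivial zeros. -/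
lemma ncard_le_of_isotropic_binary_forms {F : Type} [Field F] [Fintype F]
    {V : Type} [AddCommGroup V] [Module F V]
    (X : Set (Projectivization F V)) (U : Submodule F V) (f g h : V →ₗ[F] F)
    (hinj : ∀ p ∈ U, f p = 0 → g p = 0 → h p = 0 → p = 0)
    (hX : ∀ P ∈ X, P.rep ∈ U ∧ ∃ ξ η : F, (ξ ≠ 0 ∨ η ≠ 0) ∧
      f P.rep * ξ ^ 2 + g P.rep * (ξ * η) + h P.rep * η ^ 2 = 0) :
    X.ncard ≤ (Fintype.card F + 2).choose 2 := by
  classical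
  have key : ∀ P : X, ∃ z : Sym2 (Option F), ∃ (c : F) (a b : Option F), z = s(a, b) ∧ c ≠ 0 ∧
      f P.1.rep = c * (linX a * linX b) ∧
      g P.1.rep = c * (linX a * linY b + linY a * linX b) ∧
      h P.1.rep = c * (linY a * linY b) := by
    rintro ⟨P, hP⟩
    obtain ⟨hU, ξ, η, hne, h0⟩ := hX P hP
    obtain ⟨c, a, b, hc, h1⟩ := exists_factorization_of_zero _ _ _ ξ η
      (fun hh => P.rep_nonzero (hinj _ hU hh.1 hh.2.1 hh.2.2)) hne h0
    exact ⟨s(a, b), c, a, b, rfl, hc, h1⟩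
  choose z hz using key
  have hzinj : Function.Injective z := by
    rintro ⟨P, hP⟩ ⟨Q, hQ⟩ hPQ
    obtain ⟨c, a, b, hab, hc, h1, h2, h3⟩ := hz ⟨P, hP⟩
    obtain ⟨c', a', b', hab', hc', h1', h2', h3'⟩ := hz ⟨Q, hQ⟩
    rw [hab, hab', Sym2.eq_iff] at hPQ
    dsimp only at *
    have hlin : c' • P.rep - c • Q.rep = 0 := by
      apply hinj _ (U.sub_mem (U.smul_mem _ (hX P hP).1) (U.smul_mem _ (hX Q hQ).1))
      all_goals
        simp only [map_sub, map_smul, smul_eq_mul, h1, h2, h3, h1', h2', h3']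
        rcases hPQ with ⟨rfl, rfl⟩ | ⟨rfl, rfl⟩ <;> ring
    rw [Subtype.mk.injEq, ← P.mk_rep, ← Q.mk_rep, Projectivization.mk_eq_mk_iff']
    refine ⟨c'⁻¹ * c, ?_⟩
    rw [mul_smul, ← sub_eq_zero.mp hlin, smul_smul, inv_mul_cancel₀ hc', one_smul]
  have := Nat.card_le_card_of_injective z hzinj
  rwa [Nat.card_coe_set_eq, Nat.card_eq_fintype_card, Sym2.card, Fintype.card_option] at this

/-- A non-isotropic vector `r` orthogonal to some isotropic vector is orthogonal to an
isotropic vector which is not orthogonal to a given isotropic `s` with `b(s,r) ≠ 0`. -/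
lemma exists_isotropic_orthogonal {F V : Type} [Field F] [AddCommGroup V] [Module F V]
    (h2 : (2 : F) ≠ 0) (κ : QuadraticForm F V)
    (hnd : ∀ x : V, (∀ y : V, QuadraticMap.polar (⇑κ) x y = 0) → x = 0)
    {s r t : V} (hs : κ s = 0) (hr : κ r ≠ 0) (ht0 : t ≠ 0) (ht : κ t = 0)
    (htr : QuadraticMap.polar (⇑κ) t r = 0) (hsr : QuadraticMap.polar (⇑κ) s r ≠ 0) :
    ∃ u, κ u = 0 ∧ QuadraticMap.polar (⇑κ) u r = 0 ∧ QuadraticMap.polar (⇑κ) s u ≠ 0 := by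
  set b := QuadraticMap.polarBilin κ with hb
  have hκ : ∀ x y, κ (x + y) = κ x + κ y + b x y := QuadraticMap.map_add κ
  have hself : ∀ x, b x x = 2 * κ x := by
    intro x; simp [hb, QuadraticMap.polar_self]
  have hsymm : ∀ x y, b x y = b y x := QuadraticMap.polar_comm κ
  change b t r = 0 at htr
  change b s r ≠ 0 at hsr
  change ∃ u, κ u = 0 ∧ b u r = 0 ∧ b s u ≠ 0
  by_cases hst : b s t = 0
  swap
  · exact ⟨t, ht, htr, hst⟩
  suffices ∃ v, b v r = 0 ∧ b t v ≠ 0 ∧ b s v ≠ 0 by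
    obtain ⟨v, hvr, htv, hsv⟩ := this
    refine ⟨v + (-(κ v / b t v)) • t, ?_, ?_, ?_⟩
    · rw [hκ, QuadraticMap.map_smul, map_smul, ht, hsymm v t, smul_eq_mul, smul_eq_mul]
      field_simp
      ring
    · simp [hvr, htr]
    · simpa [hst] using hsv
  obtain ⟨y, hy⟩ : ∃ y, b t y ≠ 0 := by
    by_contra! hcon
    exact ht0 (hnd t hcon)
  have hv₁r : b (y - (b y r / (2 * κ r)) • r) r = 0 := by
    simp only [map_sub, map_smul, LinearMap.sub_apply, LinearMap.smul_apply, hself, smul_eq_mul]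
    field_simp
    ring
  have htv₁ : b t (y - (b y r / (2 * κ r)) • r) ≠ 0 := by simpa [htr] using hy
  have hs₀r : b (s - (b s r / (2 * κ r)) • r) r = 0 := by
    simp only [map_sub, map_smul, LinearMap.sub_apply, LinearMap.smul_apply, hself, smul_eq_mul]
    field_simp
    ring
  have hts₀ : b t (s - (b s r / (2 * κ r)) • r) = 0 := by
    simp [htr, hsymm t s, hst]
  have hss₀ : b s (s - (b s r / (2 * κ r)) • r) ≠ 0 := by
    simp only [map_sub, map_smul, hself, smul_eq_mul, hs]
    simp [h2, hr, hsr]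
  generalize y - (b y r / (2 * κ r)) • r = v₁ at *
  generalize s - (b s r / (2 * κ r)) • r = s₀ at *
  by_cases hsv : b s v₁ = 0
  · exact ⟨v₁ + s₀, by simp [hv₁r, hs₀r], by simpa [hts₀] using htv₁, by simpa [hsv] using hss₀⟩
  · exact ⟨v₁, hv₁r, htv₁, hsv⟩

/-- The circles through `s` meeting the circle of `r` correspond to binary quadratic forms
with a nontrivial zero. -/
lemma exists_binary_forms_of_meeting {F : Type} [Field F]
    (h2 : (2 : F) ≠ 0) (κ : QuadraticForm F (Fin 4 → F))
    (hnd : ∀ x : Fin 4 → F, (∀ y : Fin 4 → F, QuadraticMap.polar (⇑κ) x y = 0) → x = 0)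
    {s r u : Fin 4 → F} (hs : κ s = 0) (hr : κ r ≠ 0) (hu : κ u = 0)
    (hur : QuadraticMap.polar (⇑κ) u r = 0) (hsr : QuadraticMap.polar (⇑κ) s r ≠ 0)
    (hsu : QuadraticMap.polar (⇑κ) s u ≠ 0) :
    ∃ f g h : (Fin 4 → F) →ₗ[F] F,
      (∀ p, QuadraticMap.polar (⇑κ) s p = 0 → f p = 0 → g p = 0 → h p = 0 → p = 0) ∧
      ∀ p t, t ≠ 0 → κ t = 0 → QuadraticMap.polar (⇑κ) s p = 0 →
        QuadraticMap.polar (⇑κ) t p = 0 → QuadraticMap.polar (⇑κ) t r = 0 →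
        ∃ ξ η : F, (ξ ≠ 0 ∨ η ≠ 0) ∧ f p * ξ ^ 2 + g p * (ξ * η) + h p * η ^ 2 = 0 := by
  set b := QuadraticMap.polarBilin κ with hb
  have hκ : ∀ x y, κ (x + y) = κ x + κ y + b x y := QuadraticMap.map_add κ
  have hself : ∀ x, b x x = 2 * κ x := by
    intro x; simp [hb, QuadraticMap.polar_self]
  have hsymm : ∀ x y, b x y = b y x := QuadraticMap.polar_comm κ
  change b u r = 0 at hur
  change b s r ≠ 0 at hsr
  change b s u ≠ 0 at hsu
  change ∀ x, (∀ y, b x y = 0) → x = 0 at hnd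
  change ∃ f g h : (Fin 4 → F) →ₗ[F] F,
      (∀ p, b s p = 0 → f p = 0 → g p = 0 → h p = 0 → p = 0) ∧
      ∀ p t, t ≠ 0 → κ t = 0 → b s p = 0 → b t p = 0 → b t r = 0 →
        ∃ ξ η : F, (ξ ≠ 0 ∨ η ≠ 0) ∧ f p * ξ ^ 2 + g p * (ξ * η) + h p * η ^ 2 = 0
  obtain ⟨e, he, he0⟩ : ∃ e ∈ LinearMap.ker ((b s).prod ((b u).prod (b r))), e ≠ 0 := by
    apply Submodule.exists_mem_ne_zero_of_ne_bot
    apply LinearMap.ker_ne_bot_of_finrank_lt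
    simp
  obtain ⟨hse, hue, hre⟩ : b s e = 0 ∧ b u e = 0 ∧ b r e = 0 := by simpa using he
  have hli : LinearIndependent F ![s, u, r, e] := by
    rw [Fintype.linearIndependent_iff]
    intro c hc
    simp only [Fin.sum_univ_four, Matrix.cons_val] at hc
    have hc1 := congrArg (b s) hc
    have hc2 := congrArg (b u) hc
    have hc3 := congrArg (b r) hc
    simp only [map_add, map_smul, map_zero, smul_eq_mul, hself, hs, hu, hse, hue, hre, hur,
      hsymm u s, hsymm r s, hsymm r u] at hc1 hc2 hc3
    have h0 : c 0 = 0 := by simpa [hsu] using hc2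
    have h2' : c 2 = 0 := by simpa [h0, h2, hr] using hc3
    have h1 : c 1 = 0 := by simpa [h2', hsu] using hc1
    have h3 : c 3 = 0 := by simpa [h0, h1, h2', he0] using hc
    intro i
    fin_cases i <;> assumption
  have hexp : ∀ t : Fin 4 → F, ∃ τ μ ξ η : F, t = τ • s + μ • u + ξ • r + η • e := by
    intro t
    have hspan := hli.span_eq_top_of_card_eq_finrank (by simp)
    have ht : t ∈ Submodule.span F (Set.range ![s, u, r, e]) := hspan ▸ Submodule.mem_top
    obtain ⟨c, hc⟩ := (Submodule.mem_span_range_iff_exists_fun F).1 ht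
    exact ⟨c 0, c 1, c 2, c 3, by rw [← hc]; simp [Fin.sum_univ_four]⟩
  have hdet : ∀ p, b s p = 0 → b u p = 0 → b r p = 0 → b e p = 0 → p = 0 := by
    intro p h1 h2 h3 h4
    apply hnd
    intro t
    obtain ⟨τ, μ, ξ, η, rfl⟩ := hexp t
    rw [hsymm]
    simp [h1, h2, h3, h4]
  have hκe : κ e ≠ 0 := fun h => he0 (hdet e hse hue hre (by rw [hself, h, mul_zero]))
  refine ⟨(2 * κ r * b s u) • b r - (b s r * κ r) • b u, (2 * κ r * b s u) • b e,
    (b s r * κ e) • b u, ?_, ?_⟩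
  · intro p hp hf hg hh
    simp only [LinearMap.sub_apply, LinearMap.smul_apply, smul_eq_mul] at hf hg hh
    have h1 : b u p = 0 := by simpa [hsr, hκe] using hh
    have h3 : b e p = 0 := by simpa [h2, hr, hsu] using hg
    have h4 : b r p = 0 := by simpa [h1, h2, hr, hsu] using hf
    exact hdet p hp h1 h4 h3
  · intro p t ht0 ht hsp htp htr
    obtain ⟨τ, μ, ξ, η, rfl⟩ := hexp t
    simp only [hκ, QuadraticMap.map_smul, map_add, map_smul, LinearMap.add_apply,
      LinearMap.smul_apply, smul_eq_mul, hs, hu, hse, hue, hre, hur, hsp, hself,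
      hsymm e r, mul_zero, add_zero, zero_add] at ht htp htr
    simp only [LinearMap.sub_apply, LinearMap.smul_apply, smul_eq_mul]
    by_cases hne : ξ ≠ 0 ∨ η ≠ 0
    · refine ⟨ξ, η, hne, ?_⟩
      linear_combination (2 * κ r * b s u * ξ) * htp + b s r * b u p * ht
        - (b u p * (b s r * ξ + μ * b s u)) * htr
    · push Not at hne
      obtain ⟨rfl, rfl⟩ := hne
      have hτ : τ = 0 := by simpa [hsr] using htr
      subst hτ
      have hμ : μ ≠ 0 := by
        rintro rfl
        simp at ht0
      have hup : b u p = 0 := by simpa [hμ] using htp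
      exact ⟨0, 1, by simp, by simp [hup]⟩


/-- If an intersecting family `𝒻` of circles of the elliptic-quadric Möbius plane of odd
order `q` contains more than `(q+2)(q+1)/2` circles through the isotropic point `S`,
then all circles of `𝒻` pass through `S`. -/
theorem stmt_15 (q : ℕ) (hq : Odd q)
    (F : Type) [Field F] [Fintype F] (hF : Fintype.card F = q)
    (κ : QuadraticForm F (Fin 4 → F))
    (hnd : ∀ x : Fin 4 → F, (∀ y : Fin 4 → F, QuadraticMap.polar (⇑κ) x y = 0) → x = 0)
    (hell : {P : Projectivization F (Fin 4 → F) | κ P.rep = 0}.ncard = q ^ 2 + 1)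
    (𝒻 : Set (Projectivization F (Fin 4 → F)))
    (h𝒻 : ∀ P ∈ 𝒻, κ P.rep ≠ 0)
    (hint : ∀ P ∈ 𝒻, ∀ R ∈ 𝒻, ∃ S : Projectivization F (Fin 4 → F),
      κ S.rep = 0 ∧ QuadraticMap.polar (⇑κ) S.rep P.rep = 0 ∧
        QuadraticMap.polar (⇑κ) S.rep R.rep = 0)
    (S : Projectivization F (Fin 4 → F)) (hS : κ S.rep = 0)
    (hmany : ((q : ℝ) + 2) * ((q : ℝ) + 1) / 2 <
      (({P ∈ 𝒻 | QuadraticMap.polar (⇑κ) S.rep P.rep = 0}).ncard : ℝ)) :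
    ∀ P ∈ 𝒻, QuadraticMap.polar (⇑κ) S.rep P.rep = 0 := by
  intro R hR
  by_contra hSR
  have h2 : (2 : F) ≠ 0 := by
    apply Ring.two_ne_zero
    intro h
    have := FiniteField.even_card_of_char_two h
    rw [hF] at this
    exact Nat.not_odd_iff.2 this hq
  obtain ⟨T, hT, hTR, -⟩ := hint R hR R hR
  obtain ⟨u, hu, hur, hsu⟩ := exists_isotropic_orthogonal h2 κ hnd hS (h𝒻 R hR)
    T.rep_nonzero hT hTR hSR
  obtain ⟨f, g, h, hinj, hmeet⟩ := exists_binary_forms_of_meeting h2 κ hnd hS (h𝒻 R hR)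
    hu hur hSR hsu
  have hcard := ncard_le_of_isotropic_binary_forms
    {P ∈ 𝒻 | QuadraticMap.polar (⇑κ) S.rep P.rep = 0}
    (LinearMap.ker (QuadraticMap.polarBilin κ S.rep)) f g h
    (fun p hp => hinj p (by simpa using hp)) (by
      rintro P ⟨hP, hSP⟩
      obtain ⟨T', hT', hTP, hTR'⟩ := hint P hP R hR
      exact ⟨by simpa using hSP, hmeet _ _ T'.rep_nonzero hT' hSP hTP hTR'⟩)
  rw [hF] at hcard
  have hcast : (((q + 2).choose 2 : ℕ) : ℝ) = ((q : ℝ) + 2) * ((q : ℝ) + 1) / 2 := by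
    rw [Nat.cast_choose_two]
    push_cast
    ring
  rw [← hcast] at hmany
  exact absurd (Nat.cast_lt.1 hmany) (not_lt.2 hcard)
end

section
/- Let 𝒻 ⊆ 𝕄 be a nonempty intersecting family, i.e. for all f, g ∈ 𝒻 there exists x ∈ ℙ¹ with f(x) = g(x). Let n = |𝒻|, and let D be the number of ordered pairs (f, g) of distinct elements of 𝒻 that agree at exactly one point of ℙ¹. Then there exist points P, Q ∈ ℙ¹ such that the number of f ∈ 𝒻 with f(P) = Q is at least (2n + (q−1) − D/n)/(q+1), as real numbers. -/
noncomputable section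

open Classical in
/-- The number of points where two intersecting functions agree, corrected by one if they are
distinct and agree exactly once, is at least two, and is everything if they are equal. -/
lemma two_le_card_agree_add {α β : Type*} [Fintype α] {f g : α → β} (h : ∃ x, f x = g x) :
    (2 : ℝ) + (if f = g then (Fintype.card α : ℝ) - 2 else 0) ≤
      (Finset.univ.filter fun x => f x = g x).card +
        (if f ≠ g ∧ ∃! x, f x = g x then (1 : ℝ) else 0) := by
  by_cases hfg : f = g
  · subst hfg
    simp
  · obtain ⟨x, hx⟩ := h
    by_cases hu : ∃! x, f x = g x
    · have h1 : 1 ≤ (Finset.univ.filter fun x => f x = g x).card :=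
        Finset.card_pos.mpr ⟨x, by simpa using hx⟩
      have h2 : (1 : ℝ) ≤ (Finset.univ.filter fun x => f x = g x).card := by exact_mod_cast h1
      simp only [hfg, hu, ne_eq, not_false_eq_true, and_self, if_true, if_false]
      linarith
    · have h1 : 1 < (Finset.univ.filter fun x => f x = g x).card := by
        rw [Finset.one_lt_card]
        by_contra! hc
        exact hu ⟨x, hx, fun y hy => hc y (by simpa using hy) x (by simpa using hx)⟩
      have h2 : (2 : ℝ) ≤ (Finset.univ.filter fun x => f x = g x).card := by exact_mod_cast h1
      simp only [hfg, hu, and_false, if_false]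
      linarith

open Classical in
/-- Double counting the triples `(f, g, x)` with `f x = g x` in an intersecting family. -/
lemma exists_le_card_filter_apply_eq {α β : Type*} [Fintype α] (X : Finset (α → β))
    (hX : X.Nonempty) (hint : ∀ f ∈ X, ∀ g ∈ X, ∃ x, f x = g x) :
    ∃ P Q, (2 * (X.card : ℝ) + ((Fintype.card α : ℝ) - 2) -
        (((X ×ˢ X).filter fun p => p.1 ≠ p.2 ∧ ∃! x, p.1 x = p.2 x).card : ℝ) / X.card) /
          Fintype.card α ≤ ((X.filter fun f => f P = Q).card : ℝ) := by
  obtain ⟨f₀, hf₀⟩ := hX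
  obtain ⟨x₀, -⟩ := hint f₀ hf₀ f₀ hf₀
  have hn : (0 : ℝ) < X.card := by exact_mod_cast Finset.card_pos.mpr ⟨f₀, hf₀⟩
  have hN : (0 : ℝ) < Fintype.card α := by exact_mod_cast Fintype.card_pos_iff.mpr ⟨x₀⟩
  have hpairs := Finset.sum_le_sum fun p (hp : p ∈ X ×ˢ X) =>
    two_le_card_agree_add (hint p.1 (Finset.mem_product.mp hp).1 p.2 (Finset.mem_product.mp hp).2)
  have hdiag : ∑ p ∈ X ×ˢ X, (if p.1 = p.2 then (Fintype.card α : ℝ) - 2 else 0) =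
      X.card * ((Fintype.card α : ℝ) - 2) := by
    rw [Finset.sum_product]
    simp [mul_sub]
  have hswap : ∑ p ∈ X ×ˢ X, ((Finset.univ.filter fun x => p.1 x = p.2 x).card : ℝ) =
      ∑ p ∈ X ×ˢ (Finset.univ : Finset α), ((X.filter fun g => g p.2 = p.1 p.2).card : ℝ) := by
    rw [Finset.sum_product, Finset.sum_product]
    refine Finset.sum_congr rfl fun f _ => ?_
    simp only [Finset.card_filter, Nat.cast_sum]
    rw [Finset.sum_comm]
    simp only [eq_comm]
  rw [Finset.sum_add_distrib, Finset.sum_add_distrib, hdiag, hswap, Finset.sum_boole,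
    Finset.sum_const, Finset.card_product, nsmul_eq_mul] at hpairs
  push_cast at hpairs
  have hmax := Finset.exists_le_of_sum_le (s := X ×ˢ (Finset.univ : Finset α))
    (f := fun _ => (2 * (X.card : ℝ) + ((Fintype.card α : ℝ) - 2) -
      (((X ×ˢ X).filter fun p => p.1 ≠ p.2 ∧ ∃! x, p.1 x = p.2 x).card : ℝ) / X.card) /
        Fintype.card α)
    (g := fun p : (α → β) × α => ((X.filter fun g => g p.2 = p.1 p.2).card : ℝ))
    ⟨(f₀, x₀), by simp [hf₀]⟩ (by
      rw [Finset.sum_const, Finset.card_product, Finset.card_univ, nsmul_eq_mul]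
      push_cast
      refine le_trans (le_of_eq ?_) (sub_le_iff_le_add.mpr hpairs)
      field_simp)
  obtain ⟨p, -, hp⟩ := hmax
  exact ⟨p.2, p.1 p.2, hp⟩

/-- **A point not lying on few circles.** For a nonempty intersecting family `𝒻 ⊆ 𝕄` with
`n = |𝒻|` and `D` ordered pairs of distinct elements of `𝒻` agreeing in exactly one point,
some pair `(P, Q)` satisfies `|{f ∈ 𝒻 : f(P) = Q}| ≥ (2n + (q−1) − D/n)/(q+1)`. -/
theorem stmt_16 (q : ℕ) (hq : IsPrimePow q)
    (F : Type) [Field F] [Fintype F] (hF : Fintype.card F = q)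
    (𝒻 : Set (Projectivization F (Fin 2 → F) → Projectivization F (Fin 2 → F)))
    (h𝒻 : 𝒻 ⊆ pglMaps F) (hne : 𝒻.Nonempty)
    (hint : ∀ f ∈ 𝒻, ∀ g ∈ 𝒻, ∃ x, f x = g x)
    (n D : ℕ) (hn : n = 𝒻.ncard)
    (hD : D = {p : (Projectivization F (Fin 2 → F) → Projectivization F (Fin 2 → F)) ×
        (Projectivization F (Fin 2 → F) → Projectivization F (Fin 2 → F)) |
        p.1 ∈ 𝒻 ∧ p.2 ∈ 𝒻 ∧ p.1 ≠ p.2 ∧ ∃! x, p.1 x = p.2 x}.ncard) :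
    ∃ P Q : Projectivization F (Fin 2 → F),
      (2 * (n : ℝ) + ((q : ℝ) - 1) - (D : ℝ) / (n : ℝ)) / ((q : ℝ) + 1)
        ≤ (({f ∈ 𝒻 | f P = Q}).ncard : ℝ) := by
  classical
  have : Fintype (Projectivization F (Fin 2 → F)) := Fintype.ofFinite _
  have hcard : Fintype.card (Projectivization F (Fin 2 → F)) = q + 1 := by
    rw [← Nat.card_eq_fintype_card, Projectivization.card_of_finrank_two F (Fin 2 → F) (by simp),
      Nat.card_eq_fintype_card, hF]
  obtain ⟨X, rfl⟩ : ∃ X : Finset _, 𝒻 = ↑X := 𝒻.toFinite.exists_finset_coe.imp fun _ h => h.symm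
  obtain ⟨P, Q, h⟩ := exists_le_card_filter_apply_eq X (by simpa using hne) (by simpa using hint)
  refine ⟨P, Q, ?_⟩
  rw [Set.ncard_coe_finset] at hn
  have hD' : D = ((X ×ˢ X).filter fun p => p.1 ≠ p.2 ∧ ∃! x, p.1 x = p.2 x).card := by
    rw [hD, ← Set.ncard_coe_finset]
    congr 1
    ext p
    simp [and_assoc]
  have hPQ : {f | f ∈ (X : Set (_ → _)) ∧ f P = Q}.ncard = (X.filter fun f => f P = Q).card := by
    rw [← Set.ncard_coe_finset]
    congr 1
    ext f
    simp
  rw [hPQ, hn, hD']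
  rw [hcard] at h
  push_cast at h
  convert h using 3
  ring
end
end

section
/- Let q be odd and let 𝒻 ⊆ 𝕄 be an intersecting family, i.e. for all f, g ∈ 𝒻 there exists x ∈ ℙ¹ with f(x) = g(x). Then there exist points P, Q ∈ ℙ¹ such that the number of f ∈ 𝒻 with f(P) = Q is at least 2q·|𝒻|/(q+1)², as real numbers. -/
noncomputable section

section Counting

open Matrix Finset

variable {F : Type} [Field F]

/-- The standard symplectic form on `F²`. -/
def bracket (p w : Fin 2 → F) : F := p 0 * w 1 - p 1 * w 0

theorem bracket_smul_left (s : F) (p w : Fin 2 → F) : bracket (s • p) w = s * bracket p w := by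
  simp [bracket]; ring

theorem bracket_smul_right (s : F) (p w : Fin 2 → F) : bracket p (s • w) = s * bracket p w := by
  simp [bracket]; ring

theorem bracket_self (p : Fin 2 → F) : bracket p p = 0 := by
  simp [bracket]; ring

theorem bracket_sub_right (p v w : Fin 2 → F) :
    bracket p (v - w) = bracket p v - bracket p w := by
  simp [bracket]; ring

theorem bracket_swap (p w : Fin 2 → F) : bracket p w = -bracket w p := by
  simp [bracket]; ring

theorem bracket_mulVec (M : Matrix (Fin 2) (Fin 2) F) (p w : Fin 2 → F) :
    bracket (M *ᵥ p) (M *ᵥ w) = M.det * bracket p w := by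
  simp [bracket, det_fin_two, mulVec, dotProduct, Fin.sum_univ_two]; ring

theorem bracket_eq_zero_iff {p w : Fin 2 → F} (hp : p ≠ 0) :
    bracket p w = 0 ↔ ∃ s : F, w = s • p := by
  constructor
  · intro h
    unfold bracket at h
    by_cases h0 : p 0 = 0
    · have h1 : p 1 ≠ 0 := fun h1 => hp (by ext i; fin_cases i <;> simp [h0, h1])
      refine ⟨w 1 / p 1, ?_⟩
      have hw : w 0 = 0 := by simpa [h0, h1] using h
      ext i; fin_cases i
      · simp [hw, h0]
      · simp [h1]
    · refine ⟨w 0 / p 0, ?_⟩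
      ext i; fin_cases i
      · simp [h0]
      · simp; field_simp; linear_combination h
  · rintro ⟨s, rfl⟩
    rw [bracket_smul_right, bracket_self, mul_zero]

theorem exists_bracket_eq {p : Fin 2 → F} (hp : p ≠ 0) (e : F) : ∃ w, bracket p w = e := by
  by_cases h0 : p 0 = 0
  · have h1 : p 1 ≠ 0 := fun h1 => hp (by ext i; fin_cases i <;> simp [h0, h1])
    exact ⟨![-e / p 1, 0], by simp [bracket]; field_simp⟩
  · exact ⟨![0, e / p 0], by simp [bracket]; field_simp⟩

/-- A matrix is determined by its values on a basis of `F²`, which may be prescribed. -/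
theorem exists_mulVec_eq {p p' : Fin 2 → F} (h : bracket p p' ≠ 0) (w w' : Fin 2 → F) :
    ∃ N : Matrix (Fin 2) (Fin 2) F, N *ᵥ p = w ∧ N *ᵥ p' = w' := by
  unfold bracket at h
  refine ⟨!![(w 0 * p' 1 - w' 0 * p 1) / (p 0 * p' 1 - p 1 * p' 0),
    (w' 0 * p 0 - w 0 * p' 0) / (p 0 * p' 1 - p 1 * p' 0);
    (w 1 * p' 1 - w' 1 * p 1) / (p 0 * p' 1 - p 1 * p' 0),
    (w' 1 * p 0 - w 1 * p' 0) / (p 0 * p' 1 - p 1 * p' 0)], ?_, ?_⟩ <;>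
  · ext i
    fin_cases i <;> simp only [mulVec, dotProduct, Fin.sum_univ_two, of_apply, cons_val', cons_val_zero,
      cons_val_one, cons_val_fin_one, Fin.zero_eta, Fin.mk_one, div_mul_eq_mul_div, ← add_div] <;>
    rw [div_eq_iff h] <;> ring

theorem eq_of_mulVec_eq {p p' : Fin 2 → F} (h : bracket p p' ≠ 0)
    {N N' : Matrix (Fin 2) (Fin 2) F} (h1 : N *ᵥ p = N' *ᵥ p) (h2 : N *ᵥ p' = N' *ᵥ p') :
    N = N' := by
  unfold bracket at h
  ext i j
  have e1 := congrFun h1 i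
  have e2 := congrFun h2 i
  simp only [mulVec, dotProduct, Fin.sum_univ_two] at e1 e2
  apply mul_right_cancel₀ h
  fin_cases j
  · simp only [Fin.zero_eta]
    linear_combination p' 1 * e1 - p 1 * e2
  · simp only [Fin.mk_one]
    linear_combination p 0 * e2 - p' 0 * e1

theorem mulVec_ne_zero_s17 {M : Matrix (Fin 2) (Fin 2) F} (hM : M.det ≠ 0) {p : Fin 2 → F}
    (hp : p ≠ 0) : M *ᵥ p ≠ 0 := by
  intro h
  exact hp (Matrix.eq_zero_of_mulVec_eq_zero hM h)

variable [Fintype F] [DecidableEq F]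

theorem card_bracket_eq {w : Fin 2 → F} (hw : w ≠ 0) (e : F) :
    #{v | bracket w v = e} = Fintype.card F := by
  obtain ⟨v₀, hv₀⟩ := exists_bracket_eq hw e
  symm
  refine Finset.card_nbij (s := univ) (fun t => v₀ + t • w) ?_ ?_ ?_
  · intro t _
    simp only [mem_coe, mem_filter, mem_univ, true_and]
    rw [← hv₀]; simp [bracket]; ring
  · intro t _ t' _ h
    have h' : t • w = t' • w := by simpa using h
    exact smul_left_injective F hw h'
  · intro v hv
    simp only [mem_coe, mem_filter, mem_univ, true_and] at hv
    have : bracket w (v - v₀) = 0 := by rw [bracket_sub_right, hv, hv₀, sub_self]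
    obtain ⟨s, hs⟩ := (bracket_eq_zero_iff hw).1 this
    exact ⟨s, by simp, by simp [← hs]⟩

theorem card_bracket_eq_zero_left {w : Fin 2 → F} (hw : w ≠ 0) :
    #{v | bracket v w = 0} = Fintype.card F := by
  rw [← card_bracket_eq hw 0]
  congr 1; ext v
  simp only [mem_filter, mem_univ, true_and]
  rw [bracket_swap, neg_eq_zero]

theorem card_ne_zero_bracket_eq_zero {w : Fin 2 → F} (hw : w ≠ 0) :
    #{v | v ≠ 0 ∧ bracket v w = 0} = Fintype.card F - 1 := by
  rw [← card_bracket_eq_zero_left hw, ← card_erase_of_mem (a := (0 : Fin 2 → F))]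
  · congr 1; ext v; simp
  · simp only [mem_filter, mem_univ, true_and]
    simp [bracket]

omit [Field F] [DecidableEq F] in
theorem card_vec : #(univ : Finset (Fin 2 → F)) = Fintype.card F ^ 2 := by
  simp

theorem card_vec_ne_zero : #{v : Fin 2 → F | v ≠ 0} = Fintype.card F ^ 2 - 1 := by
  rw [← card_vec, ← card_erase_of_mem (mem_univ (0 : Fin 2 → F))]
  congr 1; ext v; simp

theorem card_bracket_ne_zero {w : Fin 2 → F} (hw : w ≠ 0) :
    #{v | bracket v w ≠ 0} = Fintype.card F ^ 2 - Fintype.card F := by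
  have := card_filter_add_card_filter_not (s := (univ : Finset (Fin 2 → F)))
    (fun v => bracket v w = 0)
  rw [card_vec, card_bracket_eq_zero_left hw] at this
  simp only [ne_eq]; omega

theorem card_mulVec_eq_det_eq {p w : Fin 2 → F} (hp : p ≠ 0) (hw : w ≠ 0) (d : F) :
    #{N : Matrix (Fin 2) (Fin 2) F | N.det = d ∧ N *ᵥ p = w} = Fintype.card F := by
  obtain ⟨p', hp'⟩ := exists_bracket_eq hp 1
  have hne : bracket p p' ≠ 0 := by rw [hp']; exact one_ne_zero
  rw [← card_bracket_eq hw d]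
  refine Finset.card_nbij (fun N => N *ᵥ p') ?_ ?_ ?_
  · intro N hN
    simp only [mem_coe, mem_filter, mem_univ, true_and] at hN ⊢
    rw [← hN.2, bracket_mulVec, hp', hN.1, mul_one]
  · intro N hN N' hN' h
    simp only [mem_coe, mem_filter, mem_univ, true_and] at hN hN'
    exact eq_of_mulVec_eq hne (hN.2.trans hN'.2.symm) h
  · intro v hv
    simp only [mem_coe, mem_filter, mem_univ, true_and] at hv
    obtain ⟨N, h1, h2⟩ := exists_mulVec_eq hne w v
    refine ⟨N, ?_, h2⟩
    simp only [mem_coe, mem_filter, mem_univ, true_and]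
    refine ⟨?_, h1⟩
    have := bracket_mulVec N p p'
    rw [h1, h2, hv, hp', mul_one] at this
    exact this.symm

theorem card_det_eq {d : F} (hd : d ≠ 0) :
    #{N : Matrix (Fin 2) (Fin 2) F | N.det = d} =
      (Fintype.card F ^ 2 - 1) * Fintype.card F := by
  obtain ⟨p, hp⟩ : ∃ p : Fin 2 → F, p ≠ 0 := exists_ne 0
  rw [card_eq_sum_card_fiberwise (f := fun N => N *ᵥ p)
    (t := ({v | v ≠ 0} : Finset (Fin 2 → F)))]
  · rw [sum_congr rfl (g := fun _ => Fintype.card F), sum_const, card_vec_ne_zero, smul_eq_mul]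
    intro w hw
    rw [filter_filter]
    exact card_mulVec_eq_det_eq hp (by simpa using hw) d
  · intro N hN
    simp only [mem_coe, mem_filter, mem_univ, true_and] at hN ⊢
    exact mulVec_ne_zero_s17 (by rwa [hN]) hp

/-- The number of nonzero vectors on which `M` and `N` agree. -/
def fixCount (M N : Matrix (Fin 2) (Fin 2) F) : ℕ := #{p | p ≠ 0 ∧ M *ᵥ p = N *ᵥ p}

/-- The number of nonzero vectors which `M` and `N` send to parallel vectors. -/
def parCount (M N : Matrix (Fin 2) (Fin 2) F) : ℕ :=
  #{p | p ≠ 0 ∧ bracket (M *ᵥ p) (N *ᵥ p) = 0}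

theorem card_mulVec_eq_mulVec_eq_le_of_parallel {M M' : Matrix (Fin 2) (Fin 2) F} {d : F}
    (hd : d ≠ 0) (hM : M.det = d) {p p' : Fin 2 → F} (hp : p ≠ 0) (hp' : p' ≠ 0)
    (h : bracket p p' = 0) :
    #{N : Matrix (Fin 2) (Fin 2) F | N.det = d ∧ N *ᵥ p = M *ᵥ p ∧ N *ᵥ p' = M' *ᵥ p'} ≤
      if M *ᵥ p' = M' *ᵥ p' then Fintype.card F else 0 := by
  split_ifs with h'
  · rw [← card_mulVec_eq_det_eq hp (mulVec_ne_zero_s17 (hM ▸ hd) hp) d]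
    apply card_le_card
    intro N hN
    simp only [mem_filter, mem_univ, true_and] at hN ⊢
    exact ⟨hN.1, hN.2.1⟩
  · rw [Nat.le_zero, card_eq_zero, filter_eq_empty_iff]
    rintro N - ⟨-, h1, h2⟩
    apply h'
    obtain ⟨s, rfl⟩ := (bracket_eq_zero_iff hp).1 h
    rw [← h2, mulVec_smul, mulVec_smul, h1]

theorem card_mulVec_eq_mulVec_eq_le_of_not_parallel {M M' : Matrix (Fin 2) (Fin 2) F} {d : F}
    (hM : M.det = d) {p p' : Fin 2 → F} (h : bracket p p' ≠ 0) :
    #{N : Matrix (Fin 2) (Fin 2) F | N.det = d ∧ N *ᵥ p = M *ᵥ p ∧ N *ᵥ p' = M' *ᵥ p'} ≤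
      if bracket (M *ᵥ p) (M' *ᵥ p' - M *ᵥ p') = 0 then 1 else 0 := by
  split_ifs with h'
  · rw [card_le_one]
    intro N hN N' hN'
    simp only [mem_filter, mem_univ, true_and] at hN hN'
    exact eq_of_mulVec_eq h (hN.2.1.trans hN'.2.1.symm) (hN.2.2.trans hN'.2.2.symm)
  · rw [Nat.le_zero, card_eq_zero, filter_eq_empty_iff]
    rintro N - ⟨h0, h1, h2⟩
    apply h'
    rw [bracket_sub_right, bracket_mulVec, ← h1, ← h2, bracket_mulVec, h0, hM, sub_self]

theorem sum_card_mulVec_eq_mulVec_eq_le {M M' : Matrix (Fin 2) (Fin 2) F} {d : F}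
    (hd : d ≠ 0) (hM : M.det = d) {p' : Fin 2 → F} (hp' : p' ≠ 0) :
    ∑ p : Fin 2 → F with p ≠ 0,
      #{N : Matrix (Fin 2) (Fin 2) F | N.det = d ∧ N *ᵥ p = M *ᵥ p ∧ N *ᵥ p' = M' *ᵥ p'} ≤
      (if M *ᵥ p' = M' *ᵥ p' then 2 * Fintype.card F * (Fintype.card F - 1) else 0) +
      (if bracket (M *ᵥ p') (M' *ᵥ p') ≠ 0 then Fintype.card F - 1 else 0) := by
  have hMd : M.det ≠ 0 := hM ▸ hd
  have hdisj : ∀ p : Fin 2 → F, p ≠ 0 →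
      #{N : Matrix (Fin 2) (Fin 2) F | N.det = d ∧ N *ᵥ p = M *ᵥ p ∧ N *ᵥ p' = M' *ᵥ p'} ≤
      if bracket p p' = 0 then (if M *ᵥ p' = M' *ᵥ p' then Fintype.card F else 0)
      else (if bracket (M *ᵥ p) (M' *ᵥ p' - M *ᵥ p') = 0 then 1 else 0) := by
    intro p hp
    by_cases h : bracket p p' = 0
    · rw [if_pos h]
      exact card_mulVec_eq_mulVec_eq_le_of_parallel hd hM hp hp' h
    · rw [if_neg h]
      exact card_mulVec_eq_mulVec_eq_le_of_not_parallel hM h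
  by_cases hA : M *ᵥ p' = M' *ᵥ p'
  · calc _ ≤ ∑ p : Fin 2 → F with p ≠ 0, if bracket p p' = 0 then Fintype.card F else 1 := by
          apply sum_le_sum
          intro p hp
          refine (hdisj p (by simpa using hp)).trans ?_
          rw [if_pos hA]
          split_ifs <;> simp
      _ = Fintype.card F * (Fintype.card F - 1) + (Fintype.card F ^ 2 - Fintype.card F) := by
          rw [sum_ite, sum_const, sum_const, filter_filter, filter_filter,
            card_ne_zero_bracket_eq_zero hp', ← card_bracket_ne_zero hp', smul_eq_mul, smul_eq_mul,
            mul_one, mul_comm]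
          congr 2
          ext p
          simp only [mem_filter, mem_univ, true_and, and_iff_right_iff_imp]
          rintro h rfl
          exact h (by simp [bracket])
      _ = 2 * Fintype.card F * (Fintype.card F - 1) := by
          rw [sq, ← Nat.mul_sub_one]; ring
      _ ≤ _ := by rw [if_pos hA]; exact Nat.le_add_right _ _
  · rw [if_neg hA, zero_add]
    have hu : M' *ᵥ p' - M *ᵥ p' ≠ 0 := sub_ne_zero.2 (Ne.symm hA)
    have hle : ∀ p : Fin 2 → F, p ≠ 0 →
        #{N : Matrix (Fin 2) (Fin 2) F | N.det = d ∧ N *ᵥ p = M *ᵥ p ∧ N *ᵥ p' = M' *ᵥ p'} ≤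
        if bracket p p' ≠ 0 ∧ bracket (M *ᵥ p) (M' *ᵥ p' - M *ᵥ p') = 0 then 1 else 0 := by
      intro p hp
      refine (hdisj p hp).trans ?_
      rw [if_neg hA]
      by_cases h : bracket p p' = 0
      · rw [if_pos h]
        exact Nat.zero_le _
      · rw [if_neg h, if_congr (and_iff_right h) rfl rfl]
    refine (sum_le_sum fun p hp => hle p (by simpa using hp)).trans ?_
    rw [← card_filter, filter_filter]
    split_ifs with hB
    · rw [← card_ne_zero_bracket_eq_zero hu]
      refine card_le_card_of_injOn (fun p => M *ᵥ p) ?_ ?_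
      · intro p hp
        simp only [mem_coe, mem_filter, mem_univ, true_and] at hp ⊢
        exact ⟨mulVec_ne_zero_s17 hMd hp.1, hp.2.2⟩
      · intro p _ q _ hpq
        by_contra hne
        exact mulVec_ne_zero_s17 hMd (sub_ne_zero.2 hne) (by rw [mulVec_sub]; exact sub_eq_zero.2 hpq)
    · rw [Nat.le_zero, card_eq_zero, filter_eq_empty_iff]
      rintro p - ⟨hp, hpp', h0⟩
      have hB : bracket (M *ᵥ p') (M' *ᵥ p' - M *ᵥ p') = 0 := by
        rw [bracket_sub_right, bracket_self, sub_zero]; simpa using hB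
      obtain ⟨s, hs⟩ := (bracket_eq_zero_iff (mulVec_ne_zero_s17 hMd hp')).1 hB
      have hs0 : s ≠ 0 := by rintro rfl; exact hu (by simpa using hs)
      rw [hs, bracket_smul_right, bracket_mulVec] at h0
      simp [hs0, hMd, hpp'] at h0

theorem fixCount_mul_fixCount (M M' N : Matrix (Fin 2) (Fin 2) F) :
    fixCount M N * fixCount M' N = ∑ p' : Fin 2 → F with p' ≠ 0, ∑ p : Fin 2 → F with p ≠ 0,
      if N *ᵥ p = M *ᵥ p ∧ N *ᵥ p' = M' *ᵥ p' then 1 else 0 := by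
  simp_rw [fixCount, ← filter_filter, card_filter, sum_mul_sum]
  rw [sum_comm]
  refine sum_congr rfl fun p' _ => sum_congr rfl fun p _ => ?_
  rw [ite_zero_mul_ite_zero, mul_one]
  simp only [eq_comm]

theorem card_filter_bracket_ne_zero_le {M M' : Matrix (Fin 2) (Fin 2) F}
    (h : ∃ p ≠ 0, bracket (M *ᵥ p) (M' *ᵥ p) = 0) :
    #{p : Fin 2 → F | p ≠ 0 ∧ bracket (M *ᵥ p) (M' *ᵥ p) ≠ 0} ≤
      Fintype.card F * (Fintype.card F - 1) := by
  obtain ⟨p, hp, h⟩ := h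
  rw [Nat.mul_sub_one, ← sq, ← card_bracket_ne_zero hp]
  apply card_le_card
  intro v hv
  simp only [mem_filter, mem_univ, true_and] at hv ⊢
  intro h'
  rw [bracket_swap, neg_eq_zero] at h'
  obtain ⟨s, rfl⟩ := (bracket_eq_zero_iff hp).1 h'
  apply hv.2
  rw [mulVec_smul, mulVec_smul, bracket_smul_left, bracket_smul_right, h]
  simp

theorem sum_fixCount_mul_fixCount_le {M M' : Matrix (Fin 2) (Fin 2) F} {d : F}
    (hd : d ≠ 0) (hM : M.det = d) (h : ∃ p ≠ 0, bracket (M *ᵥ p) (M' *ᵥ p) = 0) :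
    ∑ N : Matrix (Fin 2) (Fin 2) F with N.det = d, fixCount M N * fixCount M' N ≤
      2 * Fintype.card F * (Fintype.card F - 1) * fixCount M M' +
        Fintype.card F * (Fintype.card F - 1) * (Fintype.card F - 1) := by
  simp_rw [fixCount_mul_fixCount]
  rw [sum_comm]
  calc _ = ∑ p' : Fin 2 → F with p' ≠ 0, ∑ p : Fin 2 → F with p ≠ 0,
      #{N : Matrix (Fin 2) (Fin 2) F | N.det = d ∧ N *ᵥ p = M *ᵥ p ∧ N *ᵥ p' = M' *ᵥ p'} := by
        refine sum_congr rfl fun p' _ => ?_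
        rw [sum_comm]
        refine sum_congr rfl fun p _ => ?_
        rw [← filter_filter, card_filter]
    _ ≤ ∑ p' : Fin 2 → F with p' ≠ 0,
      ((if M *ᵥ p' = M' *ᵥ p' then 2 * Fintype.card F * (Fintype.card F - 1) else 0) +
      (if bracket (M *ᵥ p') (M' *ᵥ p') ≠ 0 then Fintype.card F - 1 else 0)) :=
        sum_le_sum fun p' hp' => sum_card_mulVec_eq_mulVec_eq_le hd hM (by simpa using hp')
    _ ≤ _ := by
        rw [sum_add_distrib, ← sum_filter, ← sum_filter, sum_const, sum_const, filter_filter,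
          filter_filter, smul_eq_mul, smul_eq_mul]
        apply Nat.add_le_add
        · rw [fixCount, mul_comm]
        · exact Nat.mul_le_mul_right _ (card_filter_bracket_ne_zero_le h)

theorem sum_fixCount {M : Matrix (Fin 2) (Fin 2) F} {d : F} (hd : d ≠ 0) (hM : M.det = d) :
    ∑ N : Matrix (Fin 2) (Fin 2) F with N.det = d, fixCount M N =
      (Fintype.card F ^ 2 - 1) * Fintype.card F := by
  simp_rw [fixCount, ← filter_filter _ (fun p => M *ᵥ p = _), card_filter]
  rw [sum_comm, ← card_vec_ne_zero, ← smul_eq_mul, ← sum_const]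
  refine sum_congr rfl fun p hp => ?_
  have hp : p ≠ 0 := by simpa using hp
  rw [← card_mulVec_eq_det_eq hp (mulVec_ne_zero_s17 (hM ▸ hd) hp) d, ← card_filter, filter_filter]
  simp only [eq_comm]

/-- A spectral bound for the graph on matrices of determinant `d` in which two matrices are joined
when they agree on a nonzero vector, applied to the indicator function of an intersecting set. -/
theorem sum_sum_fixCount_le {d : F} (hd : d ≠ 0) (S : Finset (Matrix (Fin 2) (Fin 2) F))
    (hS : ∀ M ∈ S, M.det = d)
    (hint : ∀ M ∈ S, ∀ M' ∈ S, ∃ p ≠ 0, bracket (M *ᵥ p) (M' *ᵥ p) = 0) :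
    ∑ M ∈ S, ∑ M' ∈ S, (fixCount M M' : ℝ) ≤
      ((Fintype.card F : ℝ) - 1) *
        (2 * Fintype.card F * #S + (#S : ℝ) ^ 2 / (Fintype.card F + 1)) := by
  set q : ℝ := (Fintype.card F : ℝ) with hq
  set k : ℝ := (#S : ℝ) with hk
  have hq1 : 1 < Fintype.card F := Fintype.one_lt_card
  have hq1' : (1 : ℝ) < q := by rw [hq]; exact_mod_cast hq1
  have hcast : ((Fintype.card F - 1 : ℕ) : ℝ) = q - 1 := by
    rw [Nat.cast_sub hq1.le, Nat.cast_one]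
  have hcast2 : ((Fintype.card F ^ 2 - 1 : ℕ) : ℝ) = q ^ 2 - 1 := by
    rw [Nat.cast_sub (Nat.one_le_pow _ _ (by omega)), Nat.cast_pow, Nat.cast_one]
  set X : Finset (Matrix (Fin 2) (Fin 2) F) := {N | N.det = d} with hX
  have hSX : S ⊆ X := fun M hM => by simpa [hX] using hS M hM
  set T : ℝ := ∑ M ∈ S, ∑ M' ∈ S, (fixCount M M' : ℝ) with hT
  set g : Matrix (Fin 2) (Fin 2) F → ℝ := fun N => ∑ M ∈ S, (fixCount M N : ℝ) with hg
  have hgg : ∑ N ∈ X, g N ^ 2 ≤ 2 * q * (q - 1) * T + q * (q - 1) ^ 2 * k ^ 2 := by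
    have h1 : ∑ N ∈ X, g N ^ 2 =
        ∑ M ∈ S, ∑ M' ∈ S, ∑ N ∈ X, (fixCount M N : ℝ) * fixCount M' N := by
      simp_rw [hg, sq, sum_mul_sum]
      rw [sum_comm]
      exact sum_congr rfl fun M _ => sum_comm
    have h2 : ∀ M ∈ S, ∀ M' ∈ S, ∑ N ∈ X, (fixCount M N : ℝ) * fixCount M' N ≤
        2 * q * (q - 1) * fixCount M M' + q * (q - 1) ^ 2 := by
      intro M hM M' hM'
      have := sum_fixCount_mul_fixCount_le hd (hS M hM) (hint M hM M' hM')
      have h3 : ((∑ N ∈ X, fixCount M N * fixCount M' N : ℕ) : ℝ) ≤ _ := Nat.cast_le.2 this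
      push_cast [hcast] at h3
      linarith
    rw [h1]
    refine (sum_le_sum fun M hM => sum_le_sum fun M' hM' => h2 M hM M' hM').trans (le_of_eq ?_)
    simp_rw [sum_add_distrib, ← mul_sum, sum_const, nsmul_eq_mul]
    ring
  have hgs : ∑ N ∈ X, g N = k * ((q ^ 2 - 1) * q) := by
    rw [hg, sum_comm, hk, ← nsmul_eq_mul, ← sum_const]
    refine sum_congr rfl fun M hM => ?_
    have := congrArg (Nat.cast (R := ℝ)) (sum_fixCount hd (hS M hM))
    push_cast [hcast2] at this
    exact this
  have hcX : (#X : ℝ) = (q ^ 2 - 1) * q := by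
    rw [hX, card_det_eq hd]; push_cast [hcast2]; rfl
  have hgS : ∑ N ∈ X, g N * (if N ∈ S then 1 else 0) = T := by
    simp_rw [mul_ite, mul_one, mul_zero]
    rw [← sum_filter, filter_mem_eq_inter, inter_eq_right.2 hSX, hT, hg, sum_comm]
  have hS1 : ∑ N ∈ X, (if N ∈ S then (1 : ℝ) else 0) = k := by
    rw [← sum_filter, filter_mem_eq_inter, inter_eq_right.2 hSX]; simp [hk]
  have hnn : 0 ≤ ∑ N ∈ X,
      (g N - 2 * q * (q - 1) * (if N ∈ S then 1 else 0) - (q - 1) * k / (q + 1)) ^ 2 :=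
    sum_nonneg fun N _ => sq_nonneg _
  have hexp : ∑ N ∈ X,
      (g N - 2 * q * (q - 1) * (if N ∈ S then 1 else 0) - (q - 1) * k / (q + 1)) ^ 2 =
      ∑ N ∈ X, g N ^ 2 - 4 * q * (q - 1) * T + 4 * q ^ 2 * (q - 1) ^ 2 * k
        - 2 * ((q - 1) * k / (q + 1)) * (k * ((q ^ 2 - 1) * q))
        + 4 * q * (q - 1) * ((q - 1) * k / (q + 1)) * k
        + ((q - 1) * k / (q + 1)) ^ 2 * ((q ^ 2 - 1) * q) := by
    have hterm : ∀ N, (g N - 2 * q * (q - 1) * (if N ∈ S then 1 else 0) -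
        (q - 1) * k / (q + 1)) ^ 2 =
        g N ^ 2 - 4 * q * (q - 1) * (g N * (if N ∈ S then 1 else 0))
        + 4 * q ^ 2 * (q - 1) ^ 2 * (if N ∈ S then 1 else 0)
        - 2 * ((q - 1) * k / (q + 1)) * g N
        + 4 * q * (q - 1) * ((q - 1) * k / (q + 1)) * (if N ∈ S then 1 else 0)
        + ((q - 1) * k / (q + 1)) ^ 2 := by
      intro N
      split_ifs <;> ring
    simp only [hterm, sum_add_distrib, sum_sub_distrib, ← mul_sum, hgS, hgs, hS1, sum_const,
      nsmul_eq_mul, hcX]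
    ring
  have hq0 : q + 1 ≠ 0 := by positivity
  have key : 2 * q * (q - 1) * T ≤ 2 * q * (q - 1) * ((q - 1) * (2 * q * k + k ^ 2 / (q + 1))) := by
    rw [hexp] at hnn
    have : q * (q - 1) ^ 2 * k ^ 2 + 4 * q ^ 2 * (q - 1) ^ 2 * k
        - 2 * ((q - 1) * k / (q + 1)) * (k * ((q ^ 2 - 1) * q))
        + 4 * q * (q - 1) * ((q - 1) * k / (q + 1)) * k
        + ((q - 1) * k / (q + 1)) ^ 2 * ((q ^ 2 - 1) * q) =
        2 * q * (q - 1) * ((q - 1) * (2 * q * k + k ^ 2 / (q + 1))) := by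
      field_simp; ring
    linarith
  exact le_of_mul_le_mul_left key (by have : 0 < q - 1 := by linarith
                                      positivity)

theorem parallel_subset {M M' : Matrix (Fin 2) (Fin 2) F} {p : Fin 2 → F} (hp : p ≠ 0)
    (h : bracket (M *ᵥ p) (M' *ᵥ p) = 0) :
    ({v | v ≠ 0 ∧ bracket v p = 0} : Finset (Fin 2 → F)) ⊆
      ({v | v ≠ 0 ∧ bracket (M *ᵥ v) (M' *ᵥ v) = 0} : Finset (Fin 2 → F)) := by
  intro v hv
  simp only [mem_filter, mem_univ, true_and] at hv ⊢
  refine ⟨hv.1, ?_⟩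
  have h' := hv.2
  rw [bracket_swap, neg_eq_zero] at h'
  obtain ⟨s, rfl⟩ := (bracket_eq_zero_iff hp).1 h'
  rw [mulVec_smul, mulVec_smul, bracket_smul_left, bracket_smul_right, h, mul_zero, mul_zero]

theorem le_fixCount {M M' : Matrix (Fin 2) (Fin 2) F} {p : Fin 2 → F} (hp : p ≠ 0)
    (h : M *ᵥ p = M' *ᵥ p) : Fintype.card F - 1 ≤ fixCount M M' := by
  rw [← card_ne_zero_bracket_eq_zero hp]
  apply card_le_card
  intro v hv
  simp only [mem_filter, mem_univ, true_and] at hv ⊢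
  refine ⟨hv.1, ?_⟩
  have h' := hv.2
  rw [bracket_swap, neg_eq_zero] at h'
  obtain ⟨s, rfl⟩ := (bracket_eq_zero_iff hp).1 h'
  rw [mulVec_smul, mulVec_smul, h]

theorem le_parCount {M M' : Matrix (Fin 2) (Fin 2) F} {p : Fin 2 → F} (hp : p ≠ 0)
    (h : bracket (M *ᵥ p) (M' *ᵥ p) = 0) : Fintype.card F - 1 ≤ parCount M M' := by
  rw [← card_ne_zero_bracket_eq_zero hp]
  exact card_le_card (parallel_subset hp h)

theorem two_mul_le_parCount {M M' : Matrix (Fin 2) (Fin 2) F} {p p' : Fin 2 → F}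
    (hp : bracket p p' ≠ 0) (h : bracket (M *ᵥ p) (M' *ᵥ p) = 0)
    (h' : bracket (M *ᵥ p') (M' *ᵥ p') = 0) : 2 * (Fintype.card F - 1) ≤ parCount M M' := by
  have hp0 : p ≠ 0 := by rintro rfl; exact hp (by simp [bracket])
  have hp0' : p' ≠ 0 := by rintro rfl; exact hp (by simp [bracket])
  have hd : Disjoint ({v | v ≠ 0 ∧ bracket v p = 0} : Finset (Fin 2 → F))
      ({v | v ≠ 0 ∧ bracket v p' = 0} : Finset (Fin 2 → F)) := by
    rw [disjoint_left]
    intro v h1 h2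
    simp only [mem_filter, mem_univ, true_and] at h1 h2
    obtain ⟨s, rfl⟩ := (bracket_eq_zero_iff h1.1).1 h1.2
    obtain ⟨t, rfl⟩ := (bracket_eq_zero_iff h1.1).1 h2.2
    rw [bracket_smul_left, bracket_smul_right, bracket_self, mul_zero, mul_zero] at hp
    exact hp rfl
  have := card_le_card (union_subset (parallel_subset hp0 h) (parallel_subset hp0' h'))
  rw [card_union_of_disjoint hd, card_ne_zero_bracket_eq_zero hp0,
    card_ne_zero_bracket_eq_zero hp0'] at this
  rw [two_mul]
  exact this

omit [Fintype F] [DecidableEq F] in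
/-- If `M'` and `M` have a relative eigenvector of eigenvalue `l`, then they also have one whose
eigenvalue is the complementary root of the relative characteristic polynomial. -/
theorem exists_second_eigenvector {M M' : Matrix (Fin 2) (Fin 2) F} (hM : M.det ≠ 0)
    {p : Fin 2 → F} (hp : p ≠ 0) {l : F} (hl : l ≠ 0) (h : M' *ᵥ p = l • M *ᵥ p)
    (hdet : M'.det ≠ l ^ 2 * M.det) :
    ∃ p', bracket p p' ≠ 0 ∧ bracket (M *ᵥ p') (M' *ᵥ p') = 0 := by
  set m : F := M'.det / (l * M.det) with hm
  have hlm : l ≠ m := by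
    intro e
    apply hdet
    rw [hm] at e
    field_simp at e
    linear_combination -e
  have hsing : (M' - l • M).det = 0 := by
    rw [← Matrix.exists_mulVec_eq_zero_iff]
    exact ⟨p, hp, by rw [sub_mulVec, smul_mulVec, h, sub_self]⟩
  have hmd : m * (l * M.det) = M'.det := by rw [hm]; field_simp
  clear_value m
  have hsing' : (M' - m • M).det = 0 := by
    have e : l * (M' - m • M).det = m * (M' - l • M).det := by
      simp only [det_fin_two, Matrix.sub_apply, Matrix.smul_apply, smul_eq_mul] at hmd ⊢
      linear_combination (m - l) * hmd
    rw [hsing, mul_zero] at e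
    exact (mul_eq_zero.1 e).resolve_left hl
  obtain ⟨p', hp', h'⟩ := Matrix.exists_mulVec_eq_zero_iff.2 hsing'
  rw [sub_mulVec, smul_mulVec, sub_eq_zero] at h'
  refine ⟨p', ?_, by rw [h', bracket_smul_right, bracket_self, mul_zero]⟩
  intro hpp
  obtain ⟨s, rfl⟩ := (bracket_eq_zero_iff hp).1 hpp
  have hs : s ≠ 0 := by rintro rfl; simp at hp'
  rw [mulVec_smul, mulVec_smul, h, smul_comm m s] at h'
  have := smul_right_injective _ hs h'
  exact hlm (smul_left_injective F (mulVec_ne_zero_s17 hM hp) this)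

/-- `fixCount` restricted to pairs of equal determinant. -/
def detFixCount (M M' : Matrix (Fin 2) (Fin 2) F) : ℕ :=
  if M.det = M'.det then fixCount M M' else 0

theorem le_parCount_add_sum_detFixCount {M M' : Matrix (Fin 2) (Fin 2) F} (hM : M.det ≠ 0)
    (hM' : M'.det ≠ 0) (h : ∃ p ≠ 0, bracket (M *ᵥ p) (M' *ᵥ p) = 0) :
    2 * (Fintype.card F - 1) +
      (if ∃ l : F, l ≠ 0 ∧ l • M = M' then 2 * Fintype.card F * (Fintype.card F - 1) else 0) ≤
    parCount M M' + ∑ l : F with l ≠ 0, detFixCount (l • M) M' := by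
  split_ifs with hpar
  · obtain ⟨l, hl, rfl⟩ := hpar
    have h1 : parCount M (l • M) = Fintype.card F ^ 2 - 1 := by
      rw [parCount, ← card_vec_ne_zero]
      congr 1; ext p
      simp only [mem_filter, mem_univ, true_and, smul_mulVec, bracket_smul_right, bracket_self,
        mul_zero, and_true]
    have h2 : Fintype.card F ^ 2 - 1 ≤ ∑ l' : F with l' ≠ 0, detFixCount (l' • M) (l • M) := by
      refine le_trans (le_of_eq ?_) (single_le_sum (f := fun l' => detFixCount (l' • M) (l • M))
        (fun _ _ => Nat.zero_le _) (a := l) (by simpa using hl))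
      rw [detFixCount, if_pos rfl, fixCount, ← card_vec_ne_zero]
      simp
    have h3 : Fintype.card F ^ 2 - 1 = (Fintype.card F + 1) * (Fintype.card F - 1) := by
      simpa using Nat.sq_sub_sq (Fintype.card F) 1
    rw [h3] at h1 h2
    rw [h1]
    nlinarith
  · obtain ⟨p, hp, h⟩ := h
    obtain ⟨l, hl⟩ := (bracket_eq_zero_iff (mulVec_ne_zero_s17 hM hp)).1 h
    have hl0 : l ≠ 0 := by
      rintro rfl
      exact mulVec_ne_zero_s17 hM' hp (by rw [hl, zero_smul])
    rw [add_zero]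
    by_cases hdet : M'.det = l ^ 2 * M.det
    · rw [two_mul]
      refine Nat.add_le_add (le_parCount hp h) ?_
      refine le_trans ?_ (single_le_sum (f := fun l' => detFixCount (l' • M) M')
        (fun _ _ => Nat.zero_le _) (a := l) (by simpa using hl0))
      rw [detFixCount, if_pos (by rw [det_smul, hdet, Fintype.card_fin])]
      exact le_fixCount hp (by rw [smul_mulVec, hl])
    · obtain ⟨p', hpp', h'⟩ := exists_second_eigenvector hM hp hl0 hl hdet
      exact (two_mul_le_parCount hpp' h h').trans (Nat.le_add_right _ _)

theorem card_scalar_ne_zero : #{l : F | l ≠ 0} = Fintype.card F - 1 := by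
  rw [← card_univ, ← card_erase_of_mem (mem_univ (0 : F))]
  congr 1; ext; simp

theorem sum_ne_zero_sum_smul {S : Finset (Matrix (Fin 2) (Fin 2) F)}
    (hS : ∀ M ∈ S, ∀ l : F, l ≠ 0 → l • M ∈ S) (f : Matrix (Fin 2) (Fin 2) F → ℕ) :
    ∑ l : F with l ≠ 0, ∑ M ∈ S, f (l • M) = (Fintype.card F - 1) * ∑ M ∈ S, f M := by
  rw [← card_scalar_ne_zero, ← smul_eq_mul, ← sum_const]
  refine sum_congr rfl fun l hl => ?_
  have hl : l ≠ 0 := by simpa using hl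
  refine sum_bij' (fun M _ => l • M) (fun M _ => l⁻¹ • M) (fun M hM => hS M hM l hl)
    (fun M hM => hS M hM _ (inv_ne_zero hl)) ?_ ?_ ?_
  · intro M _; simp [smul_smul, hl]
  · intro M _; simp [smul_smul, hl]
  · intro M _; rfl

theorem sum_sum_ite_det_eq (S : Finset (Matrix (Fin 2) (Fin 2) F))
    (f : Matrix (Fin 2) (Fin 2) F → Matrix (Fin 2) (Fin 2) F → ℕ) :
    ∑ M ∈ S, ∑ M' ∈ S, (if M.det = M'.det then f M M' else 0) =
      ∑ d, ∑ M ∈ S with M.det = d, ∑ M' ∈ S with M'.det = d, f M M' := by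
  rw [← sum_fiberwise S (fun M => M.det)]
  refine sum_congr rfl fun d _ => sum_congr rfl fun M hM => ?_
  rw [← sum_filter]
  refine sum_congr ?_ fun _ _ => rfl
  ext M'
  simp only [mem_filter] at hM ⊢
  rw [hM.2, eq_comm]

theorem card_sq_mul_eq_le_two {a b : F} (ha : a ≠ 0) : #{l : F | l ≠ 0 ∧ l ^ 2 * a = b} ≤ 2 := by
  rcases ({l : F | l ≠ 0 ∧ l ^ 2 * a = b} : Finset F).eq_empty_or_nonempty with h | ⟨m, hm⟩
  · rw [h]; simp
  · refine le_trans (card_le_card ?_) (card_le_two (a := m) (b := -m))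
    intro l hl
    simp only [mem_filter, mem_univ, true_and, mem_insert, mem_singleton] at hl hm ⊢
    exact sq_eq_sq_iff_eq_or_eq_neg.1 (mul_right_cancel₀ ha (hl.2.trans hm.2.symm))

theorem sum_card_det_sq_le {S : Finset (Matrix (Fin 2) (Fin 2) F)}
    (hdet : ∀ M ∈ S, M.det ≠ 0) (hS : ∀ M ∈ S, ∀ l : F, l ≠ 0 → l • M ∈ S) :
    (Fintype.card F - 1) * ∑ d, #{M ∈ S | M.det = d} ^ 2 ≤ 2 * #S ^ 2 := by
  have h1 : ∑ d, #{M ∈ S | M.det = d} ^ 2 =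
      ∑ M ∈ S, ∑ M' ∈ S, (if M.det = M'.det then 1 else 0) := by
    rw [sum_sum_ite_det_eq S (fun _ _ => 1)]
    simp [sq]
  rw [h1, ← sum_ne_zero_sum_smul hS (fun M => ∑ M' ∈ S, if M.det = M'.det then 1 else 0), sum_comm]
  calc _ = ∑ M ∈ S, ∑ M' ∈ S, #{l : F | l ≠ 0 ∧ l ^ 2 * M.det = M'.det} := by
        refine sum_congr rfl fun M _ => ?_
        rw [sum_comm]
        refine sum_congr rfl fun M' _ => ?_
        rw [← card_filter, filter_filter]
        simp
    _ ≤ ∑ M ∈ S, ∑ M' ∈ S, 2 :=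
        sum_le_sum fun M hM => sum_le_sum fun M' _ => card_sq_mul_eq_le_two (hdet M hM)
    _ = _ := by simp; ring

theorem sum_sum_detFixCount_le {S : Finset (Matrix (Fin 2) (Fin 2) F)}
    (hdet : ∀ M ∈ S, M.det ≠ 0) (hS : ∀ M ∈ S, ∀ l : F, l ≠ 0 → l • M ∈ S)
    (hint : ∀ M ∈ S, ∀ M' ∈ S, ∃ p ≠ 0, bracket (M *ᵥ p) (M' *ᵥ p) = 0) :
    ((∑ M ∈ S, ∑ M' ∈ S, detFixCount M M' : ℕ) : ℝ) ≤
      2 * Fintype.card F * (Fintype.card F - 1) * #S +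
        2 * (#S : ℝ) ^ 2 / (Fintype.card F + 1) := by
  have hq1 : 1 < Fintype.card F := Fintype.one_lt_card
  have hcast : ((Fintype.card F - 1 : ℕ) : ℝ) = (Fintype.card F : ℝ) - 1 := by
    rw [Nat.cast_sub hq1.le, Nat.cast_one]
  have hsq : (((Fintype.card F - 1) * ∑ d, #{M ∈ S | M.det = d} ^ 2 : ℕ) : ℝ) ≤
    ((2 * #S ^ 2 : ℕ) : ℝ) := Nat.cast_le.2 (sum_card_det_sq_le hdet hS)
  push_cast [hcast] at hsq
  have hk : ((∑ d, #{M ∈ S | M.det = d} : ℕ) : ℝ) = #S := by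
    rw [← card_eq_sum_card_fiberwise (fun _ _ => by simp)]
  push_cast at hk
  simp_rw [detFixCount]
  rw [sum_sum_ite_det_eq S fixCount]
  push_cast
  calc _ ≤ ∑ d : F, ((Fintype.card F : ℝ) - 1) * (2 * Fintype.card F * #{M ∈ S | M.det = d} +
        (#{M ∈ S | M.det = d} : ℝ) ^ 2 / (Fintype.card F + 1)) := by
        refine sum_le_sum fun d _ => ?_
        by_cases hd : d = 0
        · have : ({M ∈ S | M.det = d} : Finset _) = ∅ := by
            rw [filter_eq_empty_iff]
            intro M hM
            rw [hd]
            exact hdet M hM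
          simp [this]
        · refine sum_sum_fixCount_le hd _ (fun M hM => (mem_filter.1 hM).2) ?_
          intro M hM M' hM'
          exact hint M (mem_filter.1 hM).1 M' (mem_filter.1 hM').1
    _ = 2 * Fintype.card F * (Fintype.card F - 1) * (∑ d, (#{M ∈ S | M.det = d} : ℝ)) +
        (((Fintype.card F : ℝ) - 1) * ∑ d, (#{M ∈ S | M.det = d} : ℝ) ^ 2) /
          (Fintype.card F + 1) := by
        rw [← mul_sum, sum_add_distrib, ← mul_sum, ← sum_div]
        ring
    _ ≤ _ := by
        rw [hk]
        gcongr

theorem le_card_smul {S : Finset (Matrix (Fin 2) (Fin 2) F)}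
    (hS : ∀ M ∈ S, ∀ l : F, l ≠ 0 → l • M ∈ S) {M : Matrix (Fin 2) (Fin 2) F} (hM : M ∈ S)
    (hM0 : M.det ≠ 0) : Fintype.card F - 1 ≤ #{M' ∈ S | ∃ l : F, l ≠ 0 ∧ l • M = M'} := by
  rw [← card_scalar_ne_zero]
  refine card_le_card_of_injOn (fun l => l • M) ?_ ?_
  · intro l hl
    simp only [mem_coe, mem_filter, mem_univ, true_and] at hl ⊢
    exact ⟨hS M hM l hl, l, hl, rfl⟩
  · refine (smul_left_injective F ?_).injOn
    rintro rfl
    simp at hM0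

theorem le_sum_sum_parCount {S : Finset (Matrix (Fin 2) (Fin 2) F)}
    (hdet : ∀ M ∈ S, M.det ≠ 0) (hS : ∀ M ∈ S, ∀ l : F, l ≠ 0 → l • M ∈ S)
    (hint : ∀ M ∈ S, ∀ M' ∈ S, ∃ p ≠ 0, bracket (M *ᵥ p) (M' *ᵥ p) = 0) :
    2 * ((Fintype.card F : ℝ) - 1) * Fintype.card F * (#S : ℝ) ^ 2 / (Fintype.card F + 1) ≤
      ((∑ M ∈ S, ∑ M' ∈ S, parCount M M' : ℕ) : ℝ) := by
  have hq1 : 1 < Fintype.card F := Fintype.one_lt_card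
  have hcast : ((Fintype.card F - 1 : ℕ) : ℝ) = (Fintype.card F : ℝ) - 1 := by
    rw [Nat.cast_sub hq1.le, Nat.cast_one]
  have h1 : 2 * (Fintype.card F - 1) * #S ^ 2 +
      2 * Fintype.card F * (Fintype.card F - 1) * (Fintype.card F - 1) * #S ≤
      ∑ M ∈ S, ∑ M' ∈ S, parCount M M' +
        (Fintype.card F - 1) * ∑ M ∈ S, ∑ M' ∈ S, detFixCount M M' := by
    rw [← sum_ne_zero_sum_smul hS (fun M => ∑ M' ∈ S, detFixCount M M'),
      sum_comm (s := ({l | l ≠ 0} : Finset F)), ← sum_add_distrib]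
    have h2 : ∀ M ∈ S, 2 * (Fintype.card F - 1) * #S +
        2 * Fintype.card F * (Fintype.card F - 1) * (Fintype.card F - 1) ≤
        ∑ M' ∈ S, parCount M M' + ∑ l : F with l ≠ 0, ∑ M' ∈ S, detFixCount (l • M) M' := by
      intro M hM
      rw [sum_comm, ← sum_add_distrib]
      refine le_trans ?_ (sum_le_sum fun M' hM' =>
        le_parCount_add_sum_detFixCount (hdet M hM) (hdet M' hM') (hint M hM M' hM'))
      rw [sum_add_distrib, ← sum_filter, sum_const, sum_const, smul_eq_mul, smul_eq_mul]
      have := Nat.mul_le_mul_left (2 * Fintype.card F * (Fintype.card F - 1))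
        (le_card_smul hS hM (hdet M hM))
      linarith
    refine le_trans (le_of_eq ?_) (sum_le_sum h2)
    rw [sum_const, smul_eq_mul]
    ring
  have h1' := (Nat.cast_le (α := ℝ)).2 h1
  rw [Nat.cast_add, Nat.cast_add, Nat.cast_mul (Fintype.card F - 1) (∑ M ∈ S, _)] at h1'
  rw [hcast] at h1'
  have h3 := mul_le_mul_of_nonneg_left (sum_sum_detFixCount_le hdet hS hint)
    (show (0 : ℝ) ≤ (Fintype.card F : ℝ) - 1 by rw [← hcast]; positivity)
  have h4 := h1'.trans (add_le_add_right h3 _)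
  simp only [Nat.cast_mul, Nat.cast_pow, Nat.cast_ofNat, hcast] at h4
  have h5 : 2 * ((Fintype.card F : ℝ) - 1) * Fintype.card F * (#S : ℝ) ^ 2 / (Fintype.card F + 1) =
      2 * ((Fintype.card F : ℝ) - 1) * (#S : ℝ) ^ 2 -
        ((Fintype.card F : ℝ) - 1) * (2 * (#S : ℝ) ^ 2 / (Fintype.card F + 1)) := by
    field_simp; ring
  rw [h5]
  linarith

theorem exists_le_card_parallel {S : Finset (Matrix (Fin 2) (Fin 2) F)} (hne : S.Nonempty)
    (hdet : ∀ M ∈ S, M.det ≠ 0) (hS : ∀ M ∈ S, ∀ l : F, l ≠ 0 → l • M ∈ S)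
    (hint : ∀ M ∈ S, ∀ M' ∈ S, ∃ p ≠ 0, bracket (M *ᵥ p) (M' *ᵥ p) = 0) :
    ∃ p ≠ 0, ∃ M ∈ S, 2 * (Fintype.card F : ℝ) * #S / ((Fintype.card F : ℝ) + 1) ^ 2 ≤
      #{M' ∈ S | bracket (M *ᵥ p) (M' *ᵥ p) = 0} := by
  by_contra! hcon
  have hq1 : 1 < Fintype.card F := Fintype.one_lt_card
  have hcast2 : ((Fintype.card F ^ 2 - 1 : ℕ) : ℝ) = (Fintype.card F : ℝ) ^ 2 - 1 := by
    rw [Nat.cast_sub (Nat.one_le_pow _ _ (by omega)), Nat.cast_pow, Nat.cast_one]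
  have h1 : ∑ M ∈ S, ∑ M' ∈ S, parCount M M' =
      ∑ M ∈ S, ∑ p : Fin 2 → F with p ≠ 0, #{M' ∈ S | bracket (M *ᵥ p) (M' *ᵥ p) = 0} := by
    refine sum_congr rfl fun M _ => ?_
    simp_rw [parCount, ← filter_filter, card_filter]
    exact sum_comm
  have h2 := le_sum_sum_parCount hdet hS hint
  rw [h1] at h2
  push_cast at h2
  have hnz : ({p | p ≠ 0} : Finset (Fin 2 → F)).Nonempty := by
    obtain ⟨p, hp⟩ := exists_ne (0 : Fin 2 → F)
    exact ⟨p, by simpa using hp⟩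
  have h3 := h2.trans_lt (sum_lt_sum_of_nonempty hne fun M hM =>
    sum_lt_sum_of_nonempty hnz fun p hp => hcon p (by simpa using hp) M hM)
  simp only [sum_const, card_vec_ne_zero, nsmul_eq_mul, hcast2] at h3
  refine h3.ne ?_
  field_simp
  ring

omit [Fintype F] [DecidableEq F] in
theorem indMap_mk_eq_mk_iff (M : GL (Fin 2) F) {p w : Fin 2 → F} (hp : p ≠ 0) (hw : w ≠ 0) :
    indMap M (Projectivization.mk F p hp) = Projectivization.mk F w hw ↔
      bracket w ((M : Matrix (Fin 2) (Fin 2) F) *ᵥ p) = 0 := by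
  rw [indMap, Projectivization.map_mk, Projectivization.mk_eq_mk_iff', bracket_eq_zero_iff hw]
  exact exists_congr fun a => eq_comm

omit [Fintype F] [DecidableEq F] in
theorem det_coe_ne_zero (M : GL (Fin 2) F) : (M : Matrix (Fin 2) (Fin 2) F).det ≠ 0 :=
  M.det.ne_zero

omit [Fintype F] [DecidableEq F] in
theorem indMap_mk_eq_indMap_mk_iff (M M' : GL (Fin 2) F) {p : Fin 2 → F} (hp : p ≠ 0) :
    indMap M (Projectivization.mk F p hp) = indMap M' (Projectivization.mk F p hp) ↔
      bracket ((M : Matrix (Fin 2) (Fin 2) F) *ᵥ p) ((M' : Matrix (Fin 2) (Fin 2) F) *ᵥ p) = 0 := by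
  rw [← indMap_mk_eq_mk_iff M' hp (mulVec_ne_zero_s17 (det_coe_ne_zero M) hp), eq_comm]
  rfl

omit [Fintype F] [DecidableEq F] in
theorem indMap_eq_indMap_iff (M M' : GL (Fin 2) F) :
    indMap M = indMap M' ↔
      ∃ l : F, l ≠ 0 ∧ l • (M : Matrix (Fin 2) (Fin 2) F) = (M' : Matrix (Fin 2) (Fin 2) F) := by
  constructor
  · intro h
    have hpar : ∀ p : Fin 2 → F, p ≠ 0 → ∃ l : F,
        (M' : Matrix (Fin 2) (Fin 2) F) *ᵥ p = l • (M : Matrix (Fin 2) (Fin 2) F) *ᵥ p := by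
      intro p hp
      rw [← bracket_eq_zero_iff (mulVec_ne_zero_s17 (det_coe_ne_zero M) hp),
        ← indMap_mk_eq_indMap_mk_iff M M' hp, h]
    obtain ⟨p, hp⟩ := exists_ne (0 : Fin 2 → F)
    obtain ⟨p', hpp'⟩ := exists_bracket_eq hp 1
    have hpp : bracket p p' ≠ 0 := by rw [hpp']; exact one_ne_zero
    have hp' : p' ≠ 0 := by rintro rfl; exact hpp (by simp [bracket])
    have hs : p + p' ≠ 0 := by
      intro hs
      apply hpp
      rw [← neg_eq_of_add_eq_zero_right hs]
      simp [bracket]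
      ring
    obtain ⟨a, ha⟩ := hpar p hp
    obtain ⟨b, hb⟩ := hpar p' hp'
    obtain ⟨c, hc⟩ := hpar (p + p') hs
    have hM := bracket_mulVec (M : Matrix (Fin 2) (Fin 2) F) p p'
    have hne : bracket ((M : Matrix (Fin 2) (Fin 2) F) *ᵥ p)
        ((M : Matrix (Fin 2) (Fin 2) F) *ᵥ p') ≠ 0 := by
      rw [hM]; exact mul_ne_zero (det_coe_ne_zero M) hpp
    rw [mulVec_add, mulVec_add, ha, hb] at hc
    have hac : a = c := by
      have e : bracket (a • (M : Matrix (Fin 2) (Fin 2) F) *ᵥ p +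
          b • (M : Matrix (Fin 2) (Fin 2) F) *ᵥ p') ((M : Matrix (Fin 2) (Fin 2) F) *ᵥ p') = _ :=
        congrArg (fun v => bracket v _) hc
      apply mul_right_cancel₀ hne
      simp only [bracket, Pi.add_apply, Pi.smul_apply, smul_eq_mul] at e ⊢
      linear_combination e
    have hbc : b = c := by
      have e : bracket ((M : Matrix (Fin 2) (Fin 2) F) *ᵥ p)
          (a • (M : Matrix (Fin 2) (Fin 2) F) *ᵥ p +
          b • (M : Matrix (Fin 2) (Fin 2) F) *ᵥ p') = _ := congrArg (fun v => bracket _ v) hc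
      apply mul_right_cancel₀ hne
      simp only [bracket, Pi.add_apply, Pi.smul_apply, smul_eq_mul] at e ⊢
      linear_combination e
    have hab : b = a := hbc.trans hac.symm
    refine ⟨a, ?_, eq_of_mulVec_eq hpp ?_ ?_⟩
    · rintro rfl
      exact mulVec_ne_zero_s17 (det_coe_ne_zero M') hp (by rw [ha, zero_smul])
    · rw [smul_mulVec, ha]
    · rw [smul_mulVec, hb, hab]
  · rintro ⟨l, -, h⟩
    funext x
    induction x using Projectivization.ind with
    | h p hp =>
      rw [indMap_mk_eq_indMap_mk_iff, ← h, smul_mulVec, bracket_smul_right, bracket_self, mul_zero]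

open Classical in
/-- The matrices inducing a map in `𝒮`. -/
def lifts (𝒮 : Set (Projectivization F (Fin 2 → F) → Projectivization F (Fin 2 → F))) :
    Finset (Matrix (Fin 2) (Fin 2) F) :=
  {N | ∃ M : GL (Fin 2) F, indMap M ∈ 𝒮 ∧ (M : Matrix (Fin 2) (Fin 2) F) = N}

theorem mem_lifts {𝒮 : Set (Projectivization F (Fin 2 → F) → Projectivization F (Fin 2 → F))}
    {N : Matrix (Fin 2) (Fin 2) F} :
    N ∈ lifts 𝒮 ↔ ∃ M : GL (Fin 2) F, indMap M ∈ 𝒮 ∧ (M : Matrix (Fin 2) (Fin 2) F) = N := by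
  simp [lifts]

theorem smul_mem_lifts
    {𝒮 : Set (Projectivization F (Fin 2 → F) → Projectivization F (Fin 2 → F))}
    {N : Matrix (Fin 2) (Fin 2) F} (hN : N ∈ lifts 𝒮) {l : F} (hl : l ≠ 0) :
    l • N ∈ lifts 𝒮 := by
  obtain ⟨M, hM, rfl⟩ := mem_lifts.1 hN
  have hd : (l • (M : Matrix (Fin 2) (Fin 2) F)).det ≠ 0 := by
    rw [det_smul]; exact mul_ne_zero (pow_ne_zero _ hl) (det_coe_ne_zero M)
  refine mem_lifts.2 ⟨GeneralLinearGroup.mkOfDetNeZero _ hd, ?_, rfl⟩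
  rwa [← (indMap_eq_indMap_iff M _).2 ⟨l, hl, rfl⟩]

theorem card_lifts {𝒮 : Set (Projectivization F (Fin 2 → F) → Projectivization F (Fin 2 → F))}
    (h : 𝒮 ⊆ pglMaps F) : #(lifts 𝒮) = 𝒮.ncard * (Fintype.card F - 1) := by
  have hfin : 𝒮.Finite := (Set.finite_range indMap).subset h
  lift 𝒮 to Finset (Projectivization F (Fin 2 → F) → Projectivization F (Fin 2 → F)) using hfin
  choose! σ hσ using (fun f hf => h hf : ∀ f ∈ 𝒮, ∃ M : GL (Fin 2) F, indMap M = f)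
  rw [Set.ncard_coe_finset, ← card_scalar_ne_zero, ← card_product]
  symm
  refine card_nbij (fun x => x.2 • (σ x.1 : Matrix (Fin 2) (Fin 2) F)) ?_ ?_ ?_
  · rintro ⟨f, l⟩ hx
    simp only [mem_coe, mem_product, mem_filter, mem_univ, true_and] at hx ⊢
    exact smul_mem_lifts (mem_lifts.2 ⟨σ f, by rw [hσ f hx.1]; exact hx.1, rfl⟩) hx.2
  · rintro ⟨f, l⟩ hx ⟨f', l'⟩ hx' e
    simp only [mem_coe, mem_product, mem_filter, mem_univ, true_and] at hx hx' e
    have hff : f = f' := by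
      rw [← hσ f hx.1, ← hσ f' hx'.1, indMap_eq_indMap_iff]
      refine ⟨l'⁻¹ * l, mul_ne_zero (inv_ne_zero hx'.2) hx.2, ?_⟩
      rw [mul_smul, e, smul_smul, inv_mul_cancel₀ hx'.2, one_smul]
    subst hff
    have h0 : (σ f : Matrix (Fin 2) (Fin 2) F) ≠ 0 := fun h0 =>
      det_coe_ne_zero (σ f) (by rw [h0]; simp)
    rw [smul_left_injective F h0 e]
  · intro N hN
    obtain ⟨M, hM, rfl⟩ := mem_lifts.1 hN
    obtain ⟨l, hl, e⟩ := (indMap_eq_indMap_iff (σ (indMap M)) M).1 (hσ _ hM)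
    exact ⟨(indMap M, l), by simpa using ⟨hM, hl⟩, e⟩

end Counting

/-- For `q` odd and an intersecting family `𝒻 ⊆ 𝕄`, some pair `(P, Q)` satisfies
`|{f ∈ 𝒻 : f(P) = Q}| ≥ 2q·|𝒻|/(q+1)²`. -/
theorem stmt_17 (q : ℕ) (hq : Odd q) (hqp : IsPrimePow q)
    (F : Type) [Field F] [Fintype F] (hF : Fintype.card F = q)
    (𝒻 : Set (Projectivization F (Fin 2 → F) → Projectivization F (Fin 2 → F)))
    (h𝒻 : 𝒻 ⊆ pglMaps F)
    (hint : ∀ f ∈ 𝒻, ∀ g ∈ 𝒻, ∃ x, f x = g x) :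
    ∃ P Q : Projectivization F (Fin 2 → F),
      2 * (q : ℝ) * (𝒻.ncard : ℝ) / ((q : ℝ) + 1) ^ 2
        ≤ (({f ∈ 𝒻 | f P = Q}).ncard : ℝ) := by
  classical
  subst hF
  rcases 𝒻.eq_empty_or_nonempty with rfl | ⟨f₀, hf₀⟩
  · obtain ⟨v, hv⟩ := exists_ne (0 : Fin 2 → F)
    exact ⟨Projectivization.mk F v hv, Projectivization.mk F v hv, by simp⟩
  have hne : (lifts 𝒻).Nonempty := by
    obtain ⟨M, rfl⟩ := h𝒻 hf₀
    exact ⟨M, mem_lifts.2 ⟨M, hf₀, rfl⟩⟩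
  have hdet : ∀ N ∈ lifts 𝒻, N.det ≠ 0 := by
    intro N hN
    obtain ⟨M, -, rfl⟩ := mem_lifts.1 hN
    exact det_coe_ne_zero M
  obtain ⟨p, hp, N, hN, hle⟩ := exists_le_card_parallel hne hdet
    (fun N hN l hl => smul_mem_lifts hN hl) (by
      intro N hN N' hN'
      obtain ⟨M, hM, rfl⟩ := mem_lifts.1 hN
      obtain ⟨M', hM', rfl⟩ := mem_lifts.1 hN'
      obtain ⟨x, hx⟩ := hint _ hM _ hM'
      induction x using Projectivization.ind with
      | h p hp => exact ⟨p, hp, (indMap_mk_eq_indMap_mk_iff M M' hp).1 hx⟩)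
  have hw := mulVec_ne_zero_s17 (hdet N hN) hp
  refine ⟨Projectivization.mk F p hp, Projectivization.mk F _ hw, ?_⟩
  set 𝒮 := {f ∈ 𝒻 | f (Projectivization.mk F p hp) = Projectivization.mk F _ hw} with h𝒮
  have hfilter : {N' ∈ lifts 𝒻 | bracket (N.mulVec p) (N'.mulVec p) = 0} = lifts 𝒮 := by
    ext N'
    rw [Finset.mem_filter, mem_lifts, mem_lifts]
    constructor
    · rintro ⟨⟨M, hM, rfl⟩, h⟩
      exact ⟨M, ⟨hM, (indMap_mk_eq_mk_iff M hp hw).2 h⟩, rfl⟩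
    · rintro ⟨M, hM, rfl⟩
      exact ⟨⟨M, hM.1, rfl⟩, (indMap_mk_eq_mk_iff M hp hw).1 hM.2⟩
  rw [hfilter, card_lifts h𝒻, card_lifts (fun f hf => h𝒻 hf.1), Nat.cast_mul, Nat.cast_mul] at hle
  have hpos : (0 : ℝ) < ((Fintype.card F - 1 : ℕ) : ℝ) := by
    have : 1 < Fintype.card F := Fintype.one_lt_card
    exact_mod_cast Nat.sub_pos_of_lt this
  refine le_of_mul_le_mul_right ?_ hpos
  calc _ = _ := by ring
    _ ≤ _ := hle
end
end
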